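/- arXiv:2205.00273 — 2 statements merged into one kernel-verified Lean document; each statement's English description precedes it below -/
import Mathlib

section
/- Let D be a central division algebra of degree n over a field K (so dim_K D = n^2). Then every maximal commutative subfield P of D containing K satisfies [P : K] = n. -/
open scoped TensorProduct

/-- The algebra homomorphism `P ⊗ Dᵐᵒᵖ → End_K D` sending `p ⊗ d` to `x ↦ p * x * d`. -/
noncomputable def Subalgebra.mulLeftRight {K D : Type*} [Field K] [Ring D] [Algebra K D]
    (P : Subalgebra K D) : P ⊗[K] Dᵐᵒᵖ →ₐ[K] Module.End K D :=
  (AlgHom.mulLeftRight K D).comp (Algebra.TensorProduct.map P.val (AlgHom.id K Dᵐᵒᵖ))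

@[simp]
theorem Subalgebra.mulLeftRight_tmul_apply {K D : Type*} [Field K] [Ring D] [Algebra K D]
    (P : Subalgebra K D) (p : P) (d : Dᵐᵒᵖ) (x : D) :
    P.mulLeftRight (p ⊗ₜ d) x = p * x * d.unop := by
  simp [Subalgebra.mulLeftRight]

section DivisionAlgebra

variable {K D : Type*} [Field K] [DivisionRing D] [Algebra K D]

instance Subalgebra.isSimpleModule_range_mulLeftRight (P : Subalgebra K D) :
    IsSimpleModule P.mulLeftRight.range D := by
  refine isSimpleModule_iff_toSpanSingleton_surjective.2 ⟨inferInstance, fun x hx y ↦ ?_⟩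
  refine ⟨⟨P.mulLeftRight (1 ⊗ₜ MulOpposite.op (x⁻¹ * y)), _, rfl⟩, ?_⟩
  change P.mulLeftRight (1 ⊗ₜ MulOpposite.op (x⁻¹ * y)) x = y
  simp [hx]

/-- A `K`-linear endomorphism of `D` commuting with left multiplication by the centralizer of `P`
lies in the algebra generated by left multiplications by `P` and all right multiplications. -/
theorem Subalgebra.mem_range_mulLeftRight [FiniteDimensional K D] (P : Subalgebra K D)
    (f : Module.End K D)
    (hf : ∀ c ∈ Subalgebra.centralizer K (P : Set D), ∀ x, f (c * x) = c * f x) :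
    f ∈ P.mulLeftRight.range := by
  have smul_eq (g : Module.End P.mulLeftRight.range D) :
      ∃ c ∈ Subalgebra.centralizer K (P : Set D), ∀ x, g x = c * x := by
    have map_mul (p : P) (d x : D) : g (p * x * d) = p * g x * d := by
      simpa [Subalgebra.smul_def] using
        g.map_smul ⟨P.mulLeftRight (p ⊗ₜ MulOpposite.op d), _, rfl⟩ x
    refine ⟨g 1, (Subalgebra.mem_centralizer_iff K).2 fun p hp ↦ ?_, fun x ↦ ?_⟩
    · have h₁ := map_mul ⟨p, hp⟩ 1 1
      have h₂ := map_mul 1 p 1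
      simp only [mul_one, one_mul, OneMemClass.coe_one] at h₁ h₂
      exact h₁.symm.trans h₂
    · simpa using map_mul 1 x 1
  let F : Module.End (Module.End P.mulLeftRight.range D) D :=
    { f with
      map_smul' := fun g x ↦ by
        obtain ⟨c, hc, h⟩ := smul_eq g
        simpa [h] using hf c hc x }
  let b := Module.finBasis K D
  classical
  obtain ⟨r, hr⟩ := jacobson_density (R := P.mulLeftRight.range) F (Finset.univ.image b)
  have : f = r := b.ext fun i ↦ hr (b i) (by simp)
  exact this ▸ r.2

theorem AlgHom.mulLeftRight_injective_of_isCentral [FiniteDimensional K D]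
    [Algebra.IsCentral K D] : Function.Injective (AlgHom.mulLeftRight K D) := by
  have hsurj : Function.Surjective (AlgHom.mulLeftRight K D) := fun f ↦ by
    obtain ⟨t, ht⟩ := Subalgebra.mem_range_mulLeftRight (⊤ : Subalgebra K D) f fun c hc x ↦ by
      rw [Algebra.coe_top, Subalgebra.centralizer_univ, Algebra.IsCentral.center_eq_bot,
        Algebra.mem_bot] at hc
      obtain ⟨k, rfl⟩ := hc
      simp [← Algebra.smul_def]
    exact ⟨_, ht⟩
  refine (LinearMap.injective_iff_surjective_of_finrank_eq_finrank
    (f := (AlgHom.mulLeftRight K D).toLinearMap) ?_).2 hsurj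
  rw [Module.finrank_tensorProduct, Module.finrank_linearMap,
    (MulOpposite.opLinearEquiv K (M := D)).finrank_eq]

theorem Subalgebra.mulLeftRight_injective [FiniteDimensional K D] [Algebra.IsCentral K D]
    (P : Subalgebra K D) : Function.Injective P.mulLeftRight :=
  AlgHom.mulLeftRight_injective_of_isCentral.comp
    (Module.Flat.rTensor_preserves_injective_linearMap P.val.toLinearMap Subtype.val_injective)

end DivisionAlgebra

/-- A commutative subalgebra that is maximal among commutative subalgebras is its own
centralizer. -/
theorem Subalgebra.centralizer_le_of_maximal_commutative {K D : Type*} [CommSemiring K]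
    [Semiring D] [Algebra K D] (P : Subalgebra K D)
    (hcomm : ∀ x ∈ P, ∀ y ∈ P, x * y = y * x)
    (hmax : ∀ Q : Subalgebra K D, (∀ x ∈ Q, ∀ y ∈ Q, x * y = y * x) → P ≤ Q → Q = P) :
    Subalgebra.centralizer K (P : Set D) ≤ P := by
  intro c hc
  rw [Subalgebra.mem_centralizer_iff] at hc
  have hQ : ∀ x ∈ insert c (P : Set D), ∀ y ∈ insert c (P : Set D), x * y = y * x := by
    rintro x (rfl | hx) y (rfl | hy)
    exacts [rfl, (hc y hy).symm, hc x hx, hcomm x hx y hy]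
  have hle : (P : Set D) ⊆ Algebra.adjoin K (insert c (P : Set D)) :=
    (Set.subset_insert _ _).trans Algebra.subset_adjoin
  have := hmax (Algebra.adjoin K (insert c (P : Set D))) (fun x hx y hy ↦ ?_) hle
  · exact this ▸ Algebra.subset_adjoin (Set.mem_insert _ _)
  · exact congr_arg Subtype.val
      ((Algebra.isMulCommutative_adjoin K hQ).is_comm.comm ⟨x, hx⟩ ⟨y, hy⟩)

theorem Module.finrank_end_eq_finrank_mul_sq (K L D : Type*) [Field K] [Field L] [Algebra K L]
    [AddCommGroup D] [Module K D] [Module L D] [IsScalarTower K L D] [FiniteDimensional L D] :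
    Module.finrank K (Module.End L D) = Module.finrank K L * Module.finrank L D ^ 2 := by
  rw [← Module.finrank_mul_finrank K L (Module.End L D), Module.finrank_linearMap, sq]


/-- Let `D` be a central division algebra of degree `n` over a field `K`
(so `dim_K D = n^2`). Then every maximal commutative subfield `P` of `D` containing `K`
(formalized as a commutative `K`-subalgebra of `D` that is maximal among commutative
subalgebras; in a finite-dimensional division algebra these are exactly the maximal
subfields containing `K`) satisfies `[P : K] = n`. -/
theorem maximal_subfield_degree
    (K D : Type) [Field K] [DivisionRing D] [Algebra K D]
    [Algebra.IsCentral K D] [FiniteDimensional K D]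
    (n : ℕ) (hn : 0 < n) (hdim : Module.finrank K D = n ^ 2)
    (P : Subalgebra K D)
    (hcomm : ∀ x ∈ P, ∀ y ∈ P, x * y = y * x)
    (hmax : ∀ Q : Subalgebra K D, (∀ x ∈ Q, ∀ y ∈ Q, x * y = y * x) → P ≤ Q → Q = P) :
    Module.finrank K P = n := by
  let : CommRing P := { P.toRing with mul_comm := fun x y ↦ Subtype.ext (hcomm x x.2 y y.2) }
  let : Field P := fieldOfFiniteDimensional K P
  have : FiniteDimensional P D := Module.Finite.of_restrictScalars_finite K P D
  let ι : Module.End P D →ₗ[K] Module.End K D := LinearMap.restrictScalarsₗ K P D D K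
  have hι : Function.Injective ι := LinearMap.restrictScalars_injective K
  have hrange : ι.range = P.mulLeftRight.toLinearMap.range := by
    refine le_antisymm ?_ ?_
    · rintro _ ⟨f, rfl⟩
      exact P.mem_range_mulLeftRight _ fun c hc x ↦
        f.map_smul ⟨c, P.centralizer_le_of_maximal_commutative hcomm hmax hc⟩ x
    · rintro _ ⟨t, rfl⟩
      induction t with
      | zero => simp
      | add s t hs ht => simpa using add_mem hs ht
      | tmul p d =>
        refine ⟨{ P.mulLeftRight (p ⊗ₜ d) with map_smul' := fun q x ↦ ?_ }, rfl⟩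
        simp [Subalgebra.smul_def, ← mul_assoc, hcomm p p.2 q q.2]
  have hfinrank : Module.finrank K (Module.End P D) = Module.finrank K (P ⊗[K] Dᵐᵒᵖ) := by
    rw [← LinearMap.finrank_range_of_inj hι, hrange]
    exact LinearMap.finrank_range_of_inj P.mulLeftRight_injective
  rw [Module.finrank_end_eq_finrank_mul_sq, Module.finrank_tensorProduct,
    ← (MulOpposite.opLinearEquiv K (M := D)).finrank_eq, hdim] at hfinrank
  have hpos : 0 < Module.finrank K P := Module.finrank_pos
  have hD : Module.finrank P D = n :=
    Nat.pow_left_injective two_ne_zero (Nat.eq_of_mul_eq_mul_left hpos hfinrank)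
  have htower := Module.finrank_mul_finrank K P D
  rw [hD, hdim, sq] at htower
  exact Nat.eq_of_mul_eq_mul_right hn htower
end

section
/- (Amitsur) Let D_1 and D_2 be finite-dimensional central division algebras over a field K having the same splitting fields: for every field extension F/K, the algebra D_1 ⊗_K F is a matrix algebra over F if and only if D_2 ⊗_K F is a matrix algebra over F. Then D_1 and D_2 have the same degree, and the classes [D_1] and [D_2] generate the same cyclic subgroup of the Brauer group Br(K). -/
open scoped TensorProduct

/-- A field extension `F/K` splits `D` if `F ⊗[K] D` is a matrix algebra over `F`. -/
def SplitsAlg (K : Type) [Field K] (D : Type) [Ring D] [Algebra K D]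
    (F : Type) [Field F] [Algebra K F] : Prop :=
  ∃ m : ℕ, 0 < m ∧ Nonempty ((F ⊗[K] D) ≃ₐ[F] Matrix (Fin m) (Fin m) F)

/-- Two finite-dimensional central simple `K`-algebras are Brauer equivalent if they become
isomorphic after passing to matrix algebras. -/
def BrauerEquivalent (K : Type) [Field K] (A B : Type) [Ring A] [Algebra K A]
    [Ring B] [Algebra K B] : Prop :=
  ∃ m m' : ℕ, 0 < m ∧ 0 < m' ∧
    Nonempty ((Matrix (Fin m) (Fin m) A) ≃ₐ[K] (Matrix (Fin m') (Fin m') B))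

theorem TensorProduct.equivFinsuppOfBasisLeft_one_tmul_mul {K S D ι : Type*} [Field K] [Field S]
    [Algebra K S] [Ring D] [Algebra K D] [DecidableEq ι] (ℬ : Module.Basis ι K S) (d : D)
    (y : S ⊗[K] D) (i : ι) :
    TensorProduct.equivFinsuppOfBasisLeft ℬ ((1 ⊗ₜ d) * y) i =
      d * TensorProduct.equivFinsuppOfBasisLeft ℬ y i := by
  induction y with
  | zero => simp
  | add y z hy hz => simp [mul_add, hy, hz]
  | tmul s c => simp

theorem TensorProduct.equivFinsuppOfBasisLeft_mul_one_tmul {K S D ι : Type*} [Field K] [Field S]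
    [Algebra K S] [Ring D] [Algebra K D] [DecidableEq ι] (ℬ : Module.Basis ι K S) (d : D)
    (y : S ⊗[K] D) (i : ι) :
    TensorProduct.equivFinsuppOfBasisLeft ℬ (y * (1 ⊗ₜ d)) i =
      TensorProduct.equivFinsuppOfBasisLeft ℬ y i * d := by
  induction y with
  | zero => simp
  | add y z hy hz => simp [add_mul, hy, hz]
  | tmul s c => simp

theorem TensorProduct.eq_tmul_one_of_commute {K S D : Type*} [Field K] [Field S] [Algebra K S]
    [DivisionRing D] [Algebra K D] [Algebra.IsCentral K D] {x : S ⊗[K] D}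
    (hx : ∀ d : D, (1 ⊗ₜ d) * x = x * (1 ⊗ₜ d)) : ∃ s : S, x = s ⊗ₜ 1 := by
  classical
  let ℬ := Module.Basis.ofVectorSpace K S
  let e := TensorProduct.equivFinsuppOfBasisLeft (N := D) ℬ
  have hl (d : D) (y : S ⊗[K] D) (i) : e ((1 ⊗ₜ d) * y) i = d * e y i :=
    TensorProduct.equivFinsuppOfBasisLeft_one_tmul_mul ℬ d y i
  have hr (d : D) (y : S ⊗[K] D) (i) : e (y * (1 ⊗ₜ d)) i = e y i * d :=
    TensorProduct.equivFinsuppOfBasisLeft_mul_one_tmul ℬ d y i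
  have hc (i) : ∃ k : K, algebraMap K D k = e x i := by
    have : e x i ∈ Subalgebra.center K D := by
      rw [Subalgebra.mem_center_iff]
      intro d
      rw [← hl, ← hr, hx]
    exact Algebra.IsCentral.out this
  choose k hk using hc
  refine ⟨(e x).sum fun i _ => k i • ℬ i, ?_⟩
  conv_lhs => rw [← e.symm_apply_apply x, TensorProduct.equivFinsuppOfBasisLeft_symm_apply]
  simp only [Finsupp.sum, TensorProduct.sum_tmul, ← hk]
  refine Finset.sum_congr rfl fun i _ => ?_
  rw [Algebra.algebraMap_eq_smul_one, TensorProduct.tmul_smul, TensorProduct.smul_tmul']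

theorem TensorProduct.isSimpleRing {K S D : Type*} [Field K] [Field S] [Algebra K S]
    [DivisionRing D] [Algebra K D] [Algebra.IsCentral K D] : IsSimpleRing (S ⊗[K] D) := by
  classical
  let ℬ := Module.Basis.ofVectorSpace K S
  let e := TensorProduct.equivFinsuppOfBasisLeft (N := D) ℬ
  have hl (d : D) (y : S ⊗[K] D) (i) : e ((1 ⊗ₜ d) * y) i = d * e y i :=
    TensorProduct.equivFinsuppOfBasisLeft_one_tmul_mul ℬ d y i
  have hr (d : D) (y : S ⊗[K] D) (i) : e (y * (1 ⊗ₜ d)) i = e y i * d :=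
    TensorProduct.equivFinsuppOfBasisLeft_mul_one_tmul ℬ d y i
  refine .of_eq_bot_or_eq_top fun I => ?_
  rw [or_iff_not_imp_left, ← I.one_mem_iff]
  intro hI
  obtain ⟨x₀, hx₀I, hx₀⟩ : ∃ x ∈ I, x ≠ 0 := by
    obtain ⟨x, hx1, hx2⟩ := SetLike.exists_of_lt (bot_lt_iff_ne_bot.mpr hI : ⊥ < I)
    exact ⟨x, hx1, hx2⟩
  have hex : ∃ N : ℕ, ∃ x ∈ I, x ≠ 0 ∧ (e x).support.card = N := ⟨_, x₀, hx₀I, hx₀, rfl⟩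
  obtain ⟨x, hxI, hx, hcard⟩ := Nat.find_spec hex
  have hmin (y) (hyI : y ∈ I) (hy : (e y).support.card < (e x).support.card) : y = 0 := by
    by_contra hy0
    rw [hcard] at hy
    exact Nat.find_min hex hy ⟨y, hyI, hy0, rfl⟩
  obtain ⟨i, hi⟩ : ∃ i, e x i ≠ 0 := by
    by_contra! h
    exact hx (e.map_eq_zero_iff.mp (Finsupp.ext h))
  let y := (1 ⊗ₜ (e x i)⁻¹) * x
  have hyI : y ∈ I := I.mul_mem_left _ _ hxI
  have hey (j) : e y j = (e x i)⁻¹ * e x j := hl _ _ _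
  have hcomm (d : D) : (1 ⊗ₜ d) * y = y * (1 ⊗ₜ d) := by
    rw [← sub_eq_zero]
    refine hmin _ (I.sub_mem (I.mul_mem_left _ _ hyI) (I.mul_mem_right _ _ hyI)) ?_
    refine Finset.card_lt_card (Finset.ssubset_iff_subset_ne.mpr ⟨fun j hj => ?_, fun h => ?_⟩)
    · rw [Finsupp.mem_support_iff] at hj ⊢
      contrapose! hj
      simp [hl, hr, hey, hj]
    · have : i ∉ (e ((1 ⊗ₜ d) * y - y * (1 ⊗ₜ d))).support := by
        simp [hl, hr, hey, hi]
      exact this (h ▸ Finsupp.mem_support_iff.mpr hi)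
  obtain ⟨s, hs⟩ := TensorProduct.eq_tmul_one_of_commute hcomm
  have hs0 : s ≠ 0 := by
    rintro rfl
    have : e y i = 0 := by simp [hs]
    rw [hey, inv_mul_cancel₀ hi] at this
    exact one_ne_zero this
  have := I.mul_mem_left (s⁻¹ ⊗ₜ[K] (1 : D)) y hyI
  rwa [hs, Algebra.TensorProduct.tmul_mul_tmul, inv_mul_cancel₀ hs0, one_mul] at this

theorem TensorProduct.isCentral {K S D : Type*} [Field K] [Field S] [Algebra K S]
    [DivisionRing D] [Algebra K D] [Algebra.IsCentral K D] : Algebra.IsCentral S (S ⊗[K] D) where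
  out x hx := by
    rw [Subalgebra.mem_center_iff] at hx
    obtain ⟨s, rfl⟩ := TensorProduct.eq_tmul_one_of_commute fun d => hx (1 ⊗ₜ d)
    exact ⟨s, by simp [Algebra.TensorProduct.algebraMap_apply]⟩

theorem DivisionRing.algebraMap_surjective_of_isSepClosed {S E : Type*} [Field S] [IsSepClosed S]
    [DivisionRing E] [Algebra S E] [FiniteDimensional S E] [Algebra.IsCentral S E] :
    Function.Surjective (algebraMap S E) := by
  by_contra h
  obtain ⟨x, hx, hsep⟩ := JacobsonNoether.exists_separable_and_not_isCentral' (L := S) (D := E) (by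
    contrapose! h
    intro y
    exact (h ▸ Algebra.mem_top : y ∈ (⊥ : Subalgebra S E)))
  have hxint := hsep.isIntegral
  have hdeg := IsSepClosed.degree_eq_one_of_irreducible S (minpoly.irreducible hxint) hsep
  exact hx (minpoly.mem_range_of_degree_eq_one S x hdeg)

theorem exists_algHom_matrix_of_isSepClosed (K S D : Type*) [Field K] [Field S] [Algebra K S]
    [IsSepClosed S] [DivisionRing D] [Algebra K D] [Algebra.IsCentral K D]
    [FiniteDimensional K D] :
    ∃ n : ℕ, Module.finrank K D = n * n ∧ Nonempty (D →ₐ[K] Matrix (Fin n) (Fin n) S) := by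
  have := TensorProduct.isSimpleRing (K := K) (S := S) (D := D)
  have := TensorProduct.isCentral (K := K) (S := S) (D := D)
  have := IsArtinianRing.of_finite S (S ⊗[K] D)
  obtain ⟨n, hn, E, _, _, _, ⟨e⟩⟩ :=
    IsSimpleRing.exists_algEquiv_matrix_divisionRing_finite S (S ⊗[K] D)
  have : Algebra.IsCentral S (Matrix (Fin n) (Fin n) E) := .of_algEquiv S _ _ e
  have : Algebra.IsCentral S E := ⟨fun x hx => by
    have hmem : Matrix.scalar (Fin n) x ∈ Subalgebra.center S (Matrix (Fin n) (Fin n) E) := by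
      rw [Matrix.subalgebraCenter_eq_scalarAlgHom_map]
      exact ⟨x, hx, rfl⟩
    obtain ⟨s, hs⟩ := Algebra.IsCentral.out hmem
    exact ⟨s, by simpa [Matrix.algebraMap_matrix_apply] using congr_fun₂ hs 0 0⟩⟩
  let f : E ≃ₐ[S] S := (AlgEquiv.ofBijective (Algebra.ofId S E)
    ⟨(algebraMap S E).injective, DivisionRing.algebraMap_surjective_of_isSepClosed⟩).symm
  let g := e.trans f.mapMatrix
  refine ⟨n, ?_, ⟨(g.toAlgHom.restrictScalars K).comp Algebra.TensorProduct.includeRight⟩⟩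
  rw [← Module.finrank_baseChange (R := S), g.toLinearEquiv.finrank_eq, Module.finrank_matrix]
  simp

theorem AlgHom.exists_algEquiv_tensorProduct_matrix {K F D : Type*} [Field K] [Field F]
    [Algebra K F] [DivisionRing D] [Algebra K D] [Algebra.IsCentral K D] [FiniteDimensional K D]
    {n : ℕ} (hn : Module.finrank K D = n * n) (φ : D →ₐ[K] Matrix (Fin n) (Fin n) F) :
    ∃ e : F ⊗[K] D ≃ₐ[F] Matrix (Fin n) (Fin n) F, ∀ d, e (1 ⊗ₜ d) = φ d := by
  have := TensorProduct.isSimpleRing (K := K) (S := F) (D := D)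
  have : NeZero n := ⟨by
    rintro rfl
    exact (Module.finrank_pos (R := K) (M := D)).ne' hn⟩
  have hcomm (x : F) (y : D) : Commute (Algebra.ofId F (Matrix (Fin n) (Fin n) F) x) (φ y) :=
    Algebra.commutes x (φ y)
  let f : F ⊗[K] D →ₐ[F] Matrix (Fin n) (Fin n) F := Algebra.TensorProduct.lift _ φ hcomm
  have hinj : Function.Injective f := f.toRingHom.injective
  have hdim : Module.finrank F (F ⊗[K] D) = Module.finrank F (Matrix (Fin n) (Fin n) F) := by
    rw [Module.finrank_baseChange, hn, Module.finrank_matrix]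
    simp
  refine ⟨AlgEquiv.ofBijective f
    ⟨hinj, (LinearMap.injective_iff_surjective_of_finrank_eq_finrank hdim
      (f := f.toLinearMap)).mp hinj⟩, fun d => ?_⟩
  exact (Algebra.TensorProduct.lift_tmul _ _ hcomm 1 d).trans (by rw [map_one, one_mul])

theorem splitsAlg_iff_nonempty_algHom {K F D : Type} [Field K] [Field F]
    [Algebra K F] [DivisionRing D] [Algebra K D] [Algebra.IsCentral K D] [FiniteDimensional K D]
    {n : ℕ} (hn : Module.finrank K D = n * n) :
    SplitsAlg K D F ↔ Nonempty (D →ₐ[K] Matrix (Fin n) (Fin n) F) := by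
  constructor
  · rintro ⟨m, hm, ⟨e⟩⟩
    have h := e.toLinearEquiv.finrank_eq
    rw [Module.finrank_baseChange, hn, Module.finrank_matrix] at h
    obtain rfl : n = m := Nat.mul_self_inj.mp (by simpa using h)
    exact ⟨(e.toAlgHom.restrictScalars K).comp Algebra.TensorProduct.includeRight⟩
  · rintro ⟨φ⟩
    obtain ⟨e, -⟩ := φ.exists_algEquiv_tensorProduct_matrix hn
    refine ⟨n, Nat.pos_of_ne_zero ?_, ⟨e⟩⟩
    rintro rfl
    exact (Module.finrank_pos (R := K) (M := D)).ne' hn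

theorem AlgHom.exists_matrix_conj {K F D : Type*} [Field K] [Field F]
    [Algebra K F] [DivisionRing D] [Algebra K D] [Algebra.IsCentral K D] [FiniteDimensional K D]
    {n : ℕ} (hn : Module.finrank K D = n * n) (φ ψ : D →ₐ[K] Matrix (Fin n) (Fin n) F) :
    ∃ g : (Matrix (Fin n) (Fin n) F)ˣ, ∀ d, φ d * g = g * ψ d := by
  obtain ⟨e, he⟩ := φ.exists_algEquiv_tensorProduct_matrix hn
  obtain ⟨e', he'⟩ := ψ.exists_algEquiv_tensorProduct_matrix hn
  let t := Matrix.toLinAlgEquiv' (R := F) (n := Fin n)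
  obtain ⟨T, hT⟩ := ((t.symm.trans (e'.symm.trans e)).trans t).eq_linearEquivConjAlgEquiv
  have h1 (d : D) : t (φ d) * T.toLinearMap = T.toLinearMap * t (ψ d) := by
    have := congr($hT (t (ψ d)))
    rw [← he' d, AlgEquiv.trans_apply, AlgEquiv.trans_apply, AlgEquiv.symm_apply_apply,
      AlgEquiv.trans_apply, AlgEquiv.symm_apply_apply, he, he'] at this
    rw [this]
    refine LinearMap.ext fun x => ?_
    simp [LinearEquiv.conjAlgEquiv]
  let u : (Module.End F (Fin n → F))ˣ :=
    ⟨T.toLinearMap, T.symm.toLinearMap, by ext; simp, by ext; simp⟩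
  refine ⟨Units.map (t.symm : _ →* _) u, fun d => t.injective ?_⟩
  simpa [u] using h1 d

theorem AlgHom.span_range_matrix_eq_top {K F D : Type*} [Field K] [Field F]
    [Algebra K F] [DivisionRing D] [Algebra K D] [Algebra.IsCentral K D] [FiniteDimensional K D]
    {n : ℕ} (hn : Module.finrank K D = n * n) (φ : D →ₐ[K] Matrix (Fin n) (Fin n) F) :
    Submodule.span F (Set.range φ) = ⊤ := by
  obtain ⟨e, he⟩ := φ.exists_algEquiv_tensorProduct_matrix hn
  rw [eq_top_iff]
  rintro x -
  obtain ⟨y, rfl⟩ := e.surjective x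
  induction y with
  | zero => simp
  | add y z hy hz => rw [map_add]; exact add_mem hy hz
  | tmul s d =>
    have : s ⊗ₜ[K] d = s • (1 ⊗ₜ d) := by simp [TensorProduct.smul_tmul']
    rw [this, map_smul, he]
    exact Submodule.smul_mem _ _ (Submodule.subset_span ⟨d, rfl⟩)

theorem AlgHom.exists_eq_smul_one_of_commute {K F D : Type*} [Field K] [Field F]
    [Algebra K F] [DivisionRing D] [Algebra K D] [Algebra.IsCentral K D] [FiniteDimensional K D]
    {n : ℕ} (hn : Module.finrank K D = n * n) (φ : D →ₐ[K] Matrix (Fin n) (Fin n) F)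
    {x : Matrix (Fin n) (Fin n) F} (hx : ∀ d, φ d * x = x * φ d) : ∃ s : F, x = s • 1 := by
  have : x ∈ Subalgebra.center F (Matrix (Fin n) (Fin n) F) := by
    rw [Subalgebra.mem_center_iff]
    intro y
    have hy : y ∈ Submodule.span F (Set.range φ) := by
      rw [φ.span_range_matrix_eq_top hn]
      trivial
    induction hy using Submodule.span_induction with
    | mem y hy => obtain ⟨d, rfl⟩ := hy; exact hx d
    | zero => simp
    | add y z _ _ hy hz => rw [add_mul, mul_add, hy, hz]
    | smul s y _ hy => rw [smul_mul_assoc, mul_smul_comm, hy]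
  obtain ⟨s, hs⟩ := Algebra.IsCentral.out this
  exact ⟨s, by rw [← hs]; exact Algebra.algebraMap_eq_smul_one s⟩

theorem exists_finite_isGalois_algHom_matrix (K D : Type) [Field K] [DivisionRing D]
    [Algebra K D] [Algebra.IsCentral K D] [FiniteDimensional K D] :
    ∃ n : ℕ, Module.finrank K D = n * n ∧
      ∃ (L : Type) (_ : Field L) (_ : Algebra K L) (_ : FiniteDimensional K L) (_ : IsGalois K L),
        Nonempty (D →ₐ[K] Matrix (Fin n) (Fin n) L) := by
  obtain ⟨n, hn, ⟨φ⟩⟩ := exists_algHom_matrix_of_isSepClosed K (SeparableClosure K) D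
  let ℬ := Module.finBasis K D
  let s : Set (SeparableClosure K) := Set.range fun p : Fin (Module.finrank K D) × Fin n × Fin n =>
    φ (ℬ p.1) p.2.1 p.2.2
  let L₀ := IntermediateField.adjoin K s
  have : FiniteDimensional K L₀ :=
    IntermediateField.finiteDimensional_adjoin fun x _ => Algebra.IsIntegral.isIntegral x
  let L := IntermediateField.normalClosure K L₀ (SeparableClosure K)
  have hL₀ : L₀ ≤ L := IntermediateField.le_normalClosure L₀
  have hφ (d : D) (i j : Fin n) : φ d i j ∈ L := by
    rw [← ℬ.sum_repr d, map_sum, Matrix.sum_apply]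
    refine sum_mem fun k _ => ?_
    rw [map_smul, Matrix.smul_apply]
    exact IntermediateField.smul_mem _
      (hL₀ (IntermediateField.subset_adjoin K s ⟨(k, i, j), rfl⟩))
  refine ⟨n, hn, L, inferInstance, inferInstance, inferInstance, ⟨⟩, ⟨?_⟩⟩
  refine AlgHom.ofLinearMap
    { toFun := fun d => Matrix.of fun i j => ⟨φ d i j, hφ d i j⟩
      map_add' := fun x y => ?_
      map_smul' := fun k x => ?_ } ?_ fun x y => ?_
  · ext; simp
  · ext; simp
  · ext i j
    by_cases h : i = j <;> simp [Matrix.one_apply, h]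
  · ext i j
    simp [Matrix.mul_apply]

theorem exists_maximal_subfield (K D : Type) [Field K] [DivisionRing D]
    [Algebra K D] [FiniteDimensional K D] :
    ∃ (P : Type) (_ : Field P) (_ : Algebra K P) (ι : P →ₐ[K] D),
      ∀ x : D, (∀ p, ι p * x = x * ι p) → ∃ p, ι p = x := by
  obtain ⟨S, hS, hmax⟩ := (measure fun S : Subalgebra K D =>
    Module.finrank K D - Module.finrank K S).wf.has_min {S | ∀ x ∈ S, ∀ y ∈ S, x * y = y * x}
    ⟨⊥, fun x hx y _ => by
      obtain ⟨k, rfl⟩ := hx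
      exact Algebra.commutes k y⟩
  let _ : CommRing S :=
    { S.toRing with mul_comm := fun x y => Subtype.ext (hS x x.2 y y.2) }
  have hfield : IsField S :=
    { exists_pair_ne := ⟨0, 1, zero_ne_one⟩
      mul_comm := mul_comm
      mul_inv_cancel := fun {a} ha => by
        have : Function.Injective (LinearMap.mulLeft K a) := by
          rw [← LinearMap.ker_eq_bot, LinearMap.ker_eq_bot']
          intro m hm
          have : (a : D) * m = 0 := congr_arg Subtype.val hm
          rcases mul_eq_zero.mp this with h | h
          · exact (ha (Subtype.ext h)).elim
          · exact Subtype.ext h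
        exact LinearMap.injective_iff_surjective.mp this 1 }
  refine ⟨S, hfield.toField, S.algebra, S.val, fun x hx => ?_⟩
  let T := Algebra.adjoin K ((S : Set D) ∪ {x})
  have hT : ∀ a ∈ T, ∀ b ∈ T, a * b = b * a := by
    have hcomm : ∀ a ∈ (S : Set D) ∪ {x}, ∀ b ∈ (S : Set D) ∪ {x}, a * b = b * a := by
      rintro a (ha | rfl) b (hb | rfl)
      · exact hS a ha b hb
      · exact hx ⟨a, ha⟩
      · exact (hx ⟨b, hb⟩).symm
      · rfl
    intro a ha b hb
    have := Algebra.isMulCommutative_adjoin K hcomm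
    exact congr_arg Subtype.val (mul_comm' (⟨a, ha⟩ : T) ⟨b, hb⟩)
  have hST : S ≤ T := fun y hy => Algebra.subset_adjoin (Or.inl hy)
  have h1 : Module.finrank K T ≤ Module.finrank K S := by
    have := hmax T hT
    have hle : Module.finrank K T ≤ Module.finrank K D := Submodule.finrank_le T.toSubmodule
    simp only [WellFoundedRelation.rel, InvImage] at this
    have := not_lt.mp this
    omega
  have hxT : x ∈ T := Algebra.subset_adjoin (Or.inr rfl)
  have heq : S.toSubmodule = T.toSubmodule := Submodule.eq_of_le_of_finrank_le hST h1
  have hxS : x ∈ S.toSubmodule := heq ▸ hxT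
  exact ⟨⟨x, hxS⟩, rfl⟩

theorem exists_algHom_matrix_of_maximal_subfield {K D P : Type*} [Field K] [DivisionRing D]
    [Algebra K D] [Algebra.IsCentral K D] [FiniteDimensional K D] [Field P] [Algebra K P]
    (ι : P →ₐ[K] D) (hι : ∀ x : D, (∀ p, ι p * x = x * ι p) → ∃ p, ι p = x) {n : ℕ}
    (hn : Module.finrank K D = n * n) :
    Module.finrank K P = n ∧ Nonempty (D →ₐ[K] Matrix (Fin n) (Fin n) P) := by
  let _ : Module P D :=
    { smul := fun p x => x * ι p
      one_smul := fun x => by change x * ι 1 = x; simp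
      mul_smul := fun p q x => by
        change x * ι (p * q) = x * ι q * ι p
        rw [mul_comm p q, map_mul, mul_assoc]
      smul_zero := fun p => zero_mul _
      smul_add := fun p x y => add_mul _ _ _
      add_smul := fun p q x => by
        change x * ι (p + q) = x * ι p + x * ι q
        rw [map_add, mul_add]
      zero_smul := fun x => by change x * ι 0 = 0; simp }
  have smul_def (p : P) (x : D) : p • x = x * ι p := rfl
  have : IsScalarTower K P D := ⟨fun k p x => by simp [smul_def]⟩
  have : FiniteDimensional K P := FiniteDimensional.of_injective ι.toLinearMap ι.injective
  have : FiniteDimensional P D := FiniteDimensional.right K P D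
  let l : D →ₐ[K] Module.End P D := AlgHom.ofLinearMap
    { toFun := fun d =>
        { toFun := fun x => d * x
          map_add' := mul_add d
          map_smul' := fun p x => by simp [smul_def, mul_assoc] }
      map_add' := fun d d' => by ext x; exact add_mul d d' x
      map_smul' := fun k d => by ext x; exact smul_mul_assoc k d x }
    (by ext x; exact one_mul x) fun d d' => by ext x; exact mul_assoc d d' x
  have hcomm (p : P) (d : D) : Commute (Algebra.ofId P (Module.End P D) p) (l d) :=
    Algebra.commutes p (l d)
  let ψ : P ⊗[K] D →ₐ[P] Module.End P D := Algebra.TensorProduct.lift _ l hcomm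
  have hψ (p : P) (d x : D) : ψ (p ⊗ₜ d) x = d * x * ι p := by
    have : ψ (p ⊗ₜ d) = Algebra.ofId P (Module.End P D) p * l d :=
      Algebra.TensorProduct.lift_tmul _ _ hcomm p d
    rw [this]
    rfl
  let _ : Module (P ⊗[K] D) D := Module.compHom D ψ.toRingHom
  have hsmul (r : P ⊗[K] D) (x : D) : r • x = ψ r x := rfl
  have : IsSimpleModule (P ⊗[K] D) D := by
    rw [isSimpleModule_iff, isSimpleOrder_iff]
    refine ⟨inferInstance, fun N => ?_⟩
    rw [or_iff_not_imp_left]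
    intro hN
    obtain ⟨x, hx, hx0⟩ := N.exists_mem_ne_zero_of_ne_bot hN
    rw [eq_top_iff]
    rintro y -
    have := N.smul_mem (1 ⊗ₜ (y * x⁻¹)) hx
    rwa [hsmul, hψ, map_one, mul_one, mul_assoc, inv_mul_cancel₀ hx0, mul_one] at this
  have hE (f : Module.End (P ⊗[K] D) D) : ∃ p : P, ∀ x, f x = p • x := by
    have h1 (x : D) : f x = x * f 1 := by
      have := f.map_smul (1 ⊗ₜ x) 1
      simpa [hsmul, hψ] using this
    obtain ⟨p, hp⟩ := hι (f 1) fun p => by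
      rw [← h1]
      have := f.map_smul (p ⊗ₜ 1) 1
      simpa [hsmul, hψ] using this
    exact ⟨p, fun x => by rw [smul_def, hp, h1]⟩
  have : Module.Finite (Module.End (P ⊗[K] D) D) D := by
    obtain ⟨s, hs⟩ := Module.Finite.fg_top (R := P) (M := D)
    refine ⟨s, ?_⟩
    rw [eq_top_iff]
    rintro x -
    have hx : x ∈ Submodule.span P (s : Set D) := hs ▸ Submodule.mem_top
    induction hx using Submodule.span_induction with
    | mem x hx => exact Submodule.subset_span hx
    | zero => exact zero_mem _
    | add x y _ _ hx hy => exact add_mem hx hy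
    | smul p x _ hx =>
      let f : Module.End (P ⊗[K] D) D :=
        { toFun := fun x => p • x
          map_add' := smul_add p
          map_smul' := fun r x => ((ψ r).map_smul p x).symm }
      exact Submodule.smul_mem _ f hx
  have hsurj : Function.Surjective ψ := by
    intro f
    let f' : Module.End (Module.End (P ⊗[K] D) D) D :=
      { toFun := f
        map_add' := f.map_add
        map_smul' := fun e x => by
          obtain ⟨p, hp⟩ := hE e
          simp [hp] }
    obtain ⟨r, hr⟩ := Module.Finite.toModuleEnd_moduleEnd_surjective f'
    exact ⟨r, LinearMap.ext fun x => congr($hr x)⟩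
  have := TensorProduct.isSimpleRing (K := K) (S := P) (D := D)
  have e := AlgEquiv.ofBijective ψ ⟨ψ.toRingHom.injective, hsurj⟩
  have hdim := e.toLinearEquiv.finrank_eq
  rw [Module.finrank_baseChange, hn, Module.finrank_linearMap] at hdim
  have hDn : Module.finrank P D = n := (Nat.mul_self_inj.mp hdim).symm
  have htower := Module.finrank_mul_finrank K P D
  rw [hn, hDn] at htower
  have hn0 : 0 < n := Nat.pos_of_ne_zero (by
    rintro rfl
    exact (Module.finrank_pos (R := K) (M := D)).ne' hn)
  refine ⟨Nat.eq_of_mul_eq_mul_right hn0 htower, ⟨?_⟩⟩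
  let m : Module.End P D ≃ₐ[P] Matrix (Fin n) (Fin n) P :=
    algEquivMatrix (Module.finBasisOfFinrankEq P D hDn)
  exact (m.toAlgHom.restrictScalars K).comp l

theorem AlgHom.dvd_finrank_of_matrix {K D P : Type*} [Field K] [DivisionRing D]
    [Algebra K D] [FiniteDimensional K D] [Field P] [Algebra K P]
    {n : ℕ} (hn : Module.finrank K D = n * n) (φ : D →ₐ[K] Matrix (Fin n) (Fin n) P) :
    n ∣ Module.finrank K P := by
  let l : D →ₐ[K] Module.End P (Fin n → P) :=
    (Matrix.toLinAlgEquiv'.toAlgHom.restrictScalars K).comp φ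
  let _ : Module D (Fin n → P) := Module.compHom _ l.toRingHom
  have : IsScalarTower K D (Fin n → P) := ⟨fun k d x => by
    change l (k • d) x = k • l d x
    rw [map_smul]
    rfl⟩
  have h := Module.finrank_mul_finrank K D (Fin n → P)
  rw [hn, ← Module.finrank_mul_finrank K P (Fin n → P), Module.finrank_fin_fun] at h
  have hn0 : 0 < n := Nat.pos_of_ne_zero (by
    rintro rfl
    exact (Module.finrank_pos (R := K) (M := D)).ne' hn)
  refine ⟨Module.finrank D (Fin n → P), Nat.eq_of_mul_eq_mul_right hn0 ?_⟩
  rw [← h]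
  ring

/-- The substitution on polynomials in the entries of a square matrix `X` of variables which
acts on the coefficients through `σ` and sends `X` to `p * X`. -/
noncomputable def MvPolynomial.semilinearSubst {K L ι : Type*} [Field K] [Field L] [Algebra K L]
    [Fintype ι] (σ : L →ₐ[K] L) (p : Matrix ι ι L) :
    MvPolynomial (ι × ι) L →ₐ[K] MvPolynomial (ι × ι) L :=
  { MvPolynomial.eval₂Hom ((MvPolynomial.C : L →+* MvPolynomial (ι × ι) L).comp (σ : L →+* L))
      (fun ij => ∑ k, MvPolynomial.C (p ij.1 k) * MvPolynomial.X (k, ij.2)) with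
    commutes' := fun k => by
      simp [MvPolynomial.algebraMap_apply] }

theorem MvPolynomial.semilinearSubst_apply {K L ι : Type*} [Field K] [Field L] [Algebra K L]
    [Fintype ι] (σ : L →ₐ[K] L) (p : Matrix ι ι L) (f : MvPolynomial (ι × ι) L) :
    semilinearSubst σ p f = eval₂ ((C : L →+* MvPolynomial (ι × ι) L).comp (σ : L →+* L))
      (fun ij => ∑ k, C (p ij.1 k) * X (k, ij.2)) f := rfl

theorem MvPolynomial.semilinearSubst_C {K L ι : Type*} [Field K] [Field L] [Algebra K L]
    [Fintype ι] (σ : L →ₐ[K] L) (p : Matrix ι ι L) (a : L) :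
    semilinearSubst σ p (C a) = C (σ a) := by
  simp [semilinearSubst_apply]

theorem MvPolynomial.semilinearSubst_X {K L ι : Type*} [Field K] [Field L] [Algebra K L]
    [Fintype ι] (σ : L →ₐ[K] L) (p : Matrix ι ι L) (i j : ι) :
    semilinearSubst σ p (X (i, j)) = ∑ k, C (p i k) * X (k, j) := by
  simp [semilinearSubst_apply]

theorem MvPolynomial.semilinearSubst_semilinearSubst {K L ι : Type*} [Field K] [Field L]
    [Algebra K L] [Fintype ι] (σ τ : L →ₐ[K] L) (p q : Matrix ι ι L)
    (f : MvPolynomial (ι × ι) L) :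
    semilinearSubst σ p (semilinearSubst τ q f) =
      semilinearSubst (σ.comp τ) (q.map σ * p) f := by
  induction f using MvPolynomial.induction_on with
  | C a => simp only [semilinearSubst_C, AlgHom.comp_apply]
  | add f g hf hg => simp only [map_add, hf, hg]
  | mul_X f ij hf =>
    obtain ⟨i, j⟩ := ij
    simp only [map_mul, hf, semilinearSubst_X, map_sum, semilinearSubst_C, Matrix.mul_apply,
      Finset.mul_sum, Finset.sum_mul, Matrix.map_apply]
    rw [Finset.sum_comm]
    simp only [mul_assoc]

theorem MvPolynomial.semilinearSubst_id {K L ι : Type*} [Field K] [Field L] [Algebra K L]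
    [Fintype ι] [DecidableEq ι] (f : MvPolynomial (ι × ι) L) :
    semilinearSubst (AlgHom.id K L) (1 : Matrix ι ι L) f = f := by
  induction f using MvPolynomial.induction_on with
  | C a => simp [semilinearSubst_C]
  | add f g hf hg => simp only [map_add, hf, hg]
  | mul_X f ij hf =>
    obtain ⟨i, j⟩ := ij
    simp only [map_mul, hf, semilinearSubst_X]
    congr 1
    rw [Finset.sum_eq_single i] <;> simp +contextual [eq_comm]

theorem MvPolynomial.semilinearSubst_bijective {K L ι : Type*} [Field K] [Field L] [Algebra K L]
    [Fintype ι] [DecidableEq ι] (σ : L ≃ₐ[K] L) (c : (Matrix ι ι L)ˣ) :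
    Function.Bijective (semilinearSubst (σ : L →ₐ[K] L) (↑c⁻¹ : Matrix ι ι L)) := by
  refine Function.bijective_iff_has_inverse.mpr ⟨semilinearSubst (σ.symm : L →ₐ[K] L)
    ((c : Matrix ι ι L).map σ.symm), fun f => ?_, fun f => ?_⟩
  · rw [semilinearSubst_semilinearSubst]
    have h1 : (σ.symm : L →ₐ[K] L).comp (σ : L →ₐ[K] L) = AlgHom.id K L := by ext; simp
    have h2 : (↑c⁻¹ : Matrix ι ι L).map σ.symm * (c : Matrix ι ι L).map σ.symm = 1 := by
      rw [← Matrix.map_mul, Units.inv_mul, Matrix.map_one _ (map_zero _) (map_one _)]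
    exact (congr_arg₂ (fun s p => semilinearSubst s p f) h1 h2).trans (semilinearSubst_id f)
  · rw [semilinearSubst_semilinearSubst]
    have h1 : (σ : L →ₐ[K] L).comp (σ.symm : L →ₐ[K] L) = AlgHom.id K L := by ext; simp
    have h2 : ((c : Matrix ι ι L).map σ.symm).map σ * (↑c⁻¹ : Matrix ι ι L) = 1 := by
      rw [Matrix.map_map]
      have : (σ ∘ σ.symm : L → L) = id := by ext; simp
      rw [this, Matrix.map_id, Units.mul_inv]
    exact (congr_arg₂ (fun s p => semilinearSubst s p f) h1 h2).trans (semilinearSubst_id f)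

theorem MvPolynomial.IsHomogeneous.semilinearSubst {K L ι : Type*} [Field K] [Field L]
    [Algebra K L] [Fintype ι] (σ : L →ₐ[K] L) (p : Matrix ι ι L) {f : MvPolynomial (ι × ι) L}
    {d : ℕ} (hf : f.IsHomogeneous d) : (semilinearSubst σ p f).IsHomogeneous d := by
  rw [semilinearSubst_apply]
  have := hf.eval₂ (n := 1) ((C : L →+* MvPolynomial (ι × ι) L).comp (σ : L →+* L))
    (fun ij => ∑ k, C (p ij.1 k) * X (k, ij.2)) (fun a => isHomogeneous_C _ _)
    fun ij => IsHomogeneous.sum _ _ _ fun k _ => isHomogeneous_C_mul_X _ _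
  simpa using this

theorem MvPolynomial.homogeneousComponent_semilinearSubst {K L ι : Type*} [Field K] [Field L]
    [Algebra K L] [Fintype ι] (σ : L →ₐ[K] L) (p : Matrix ι ι L) (f : MvPolynomial (ι × ι) L)
    (d : ℕ) :
    homogeneousComponent d (semilinearSubst σ p f) =
      semilinearSubst σ p (homogeneousComponent d f) := by
  induction f using MvPolynomial.induction_on' with
  | monomial u a =>
    have h := isHomogeneous_monomial (σ := ι × ι) a (rfl : u.degree = u.degree)
    rw [homogeneousComponent_of_mem h, homogeneousComponent_of_mem (h.semilinearSubst σ p)]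
    split_ifs <;> simp
  | add f g hf hg => simp only [map_add, hf, hg]

theorem MvPolynomial.IsHomogeneous.semilinearSubst_smul {K L ι : Type*} [Field K] [Field L]
    [Algebra K L] [Fintype ι] (σ : L →ₐ[K] L) (p : Matrix ι ι L) (t : L)
    {f : MvPolynomial (ι × ι) L} {d : ℕ} (hf : f.IsHomogeneous d) :
    MvPolynomial.semilinearSubst σ (t • p) f =
      C (t ^ d) * MvPolynomial.semilinearSubst σ p f := by
  simp only [semilinearSubst_apply, eval₂_eq, Finset.mul_sum]
  refine Finset.sum_congr rfl fun u hu => ?_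
  have hd : u.degree = d := by
    by_contra h
    exact (mem_support_iff.mp hu) (hf.coeff_eq_zero h)
  have h (ij : ι × ι) : ∑ k, C ((t • p) ij.1 k) * (X (k, ij.2) : MvPolynomial (ι × ι) L) =
      C t * ∑ k, C (p ij.1 k) * X (k, ij.2) := by
    simp [Finset.mul_sum, mul_assoc]
  simp only [h, mul_pow, Finset.prod_mul_distrib, Finset.prod_pow_eq_pow_sum]
  rw [← hd, Finsupp.degree]
  simp only [map_pow]
  ring_nf
  rfl

theorem MvPolynomial.toAlgHom_comp_semilinearSubst_injective {K L ι : Type*} [Field K] [Field L]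
    [Algebra K L] [Fintype ι] [DecidableEq ι] (σ : L ≃ₐ[K] L) (c : (Matrix ι ι L)ˣ) :
    Function.Injective ((IsScalarTower.toAlgHom K (MvPolynomial (ι × ι) L)
      (FractionRing (MvPolynomial (ι × ι) L))).comp
        (semilinearSubst (σ : L →ₐ[K] L) (↑c⁻¹ : Matrix ι ι L))) :=
  (IsFractionRing.injective _ _).comp (semilinearSubst_bijective σ c).injective

/-- The extension of `MvPolynomial.semilinearSubst` to rational functions. -/
noncomputable def MvPolynomial.fractionSubst {K L ι : Type*} [Field K] [Field L] [Algebra K L]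
    [Fintype ι] [DecidableEq ι] (σ : L ≃ₐ[K] L) (c : (Matrix ι ι L)ˣ) :
    FractionRing (MvPolynomial (ι × ι) L) →ₐ[K] FractionRing (MvPolynomial (ι × ι) L) :=
  IsFractionRing.liftAlgHom (toAlgHom_comp_semilinearSubst_injective σ c)

theorem MvPolynomial.fractionSubst_algebraMap {K L ι : Type*} [Field K] [Field L] [Algebra K L]
    [Fintype ι] [DecidableEq ι] (σ : L ≃ₐ[K] L) (c : (Matrix ι ι L)ˣ)
    (f : MvPolynomial (ι × ι) L) :
    fractionSubst σ c (algebraMap _ _ f) =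
      algebraMap _ _ (semilinearSubst (σ : L →ₐ[K] L) (↑c⁻¹ : Matrix ι ι L) f) := by
  rw [fractionSubst, IsFractionRing.liftAlgHom_apply]
  exact IsFractionRing.lift_algebraMap (toAlgHom_comp_semilinearSubst_injective σ c) f

/-- Over the field of rational functions in the entries of the generic matrix `X`, the
representation `φ` is conjugate by `X` to a representation which is fixed by all the semilinear
substitutions compatible with `φ`. -/
theorem AlgHom.exists_forall_map_fractionSubst_eq {K L A : Type*} [Field K] [Field L]
    [Algebra K L] [Ring A] [Algebra K A] {n : ℕ} (φ : A →ₐ[K] Matrix (Fin n) (Fin n) L) :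
    ∃ ρ : A →ₐ[K] Matrix (Fin n) (Fin n)
        (FractionRing (MvPolynomial (Fin n × Fin n) L)),
      ∀ (σ : L ≃ₐ[K] L) (c : (Matrix (Fin n) (Fin n) L)ˣ),
        (∀ a, (c : Matrix (Fin n) (Fin n) L) * (φ a).map σ = φ a * c) →
        ∀ a, (ρ a).map (MvPolynomial.fractionSubst σ c) = ρ a := by
  let R := MvPolynomial (Fin n × Fin n) L
  let Ω := FractionRing R
  let X : Matrix (Fin n) (Fin n) Ω :=
    (algebraMap R Ω).mapMatrix (Matrix.mvPolynomialX (Fin n) (Fin n) L)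
  have hX : IsUnit X := by
    rw [Matrix.isUnit_iff_isUnit_det, isUnit_iff_ne_zero, ← RingHom.map_det]
    exact (map_ne_zero_iff _ (IsFractionRing.injective R Ω)).mpr
      (Matrix.det_mvPolynomialX_ne_zero _ _)
  obtain ⟨u, hu⟩ := hX
  let j : L →ₐ[K] Ω := IsScalarTower.toAlgHom K L Ω
  let φΩ : A →ₐ[K] Matrix (Fin n) (Fin n) Ω := j.mapMatrix.comp φ
  refine ⟨(MulSemiringAction.toAlgHom K _ (ConjAct.toConjAct u⁻¹)).comp φΩ, fun σ c hc a => ?_⟩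
  let θ : Ω →ₐ[K] Ω := MvPolynomial.fractionSubst σ c
  change θ.mapMatrix (ConjAct.toConjAct u⁻¹ • φΩ a) = ConjAct.toConjAct u⁻¹ • φΩ a
  simp only [ConjAct.units_smul_def, ConjAct.ofConjAct_toConjAct, inv_inv, map_mul]
  have hθj (x : L) : θ (j x) = j (σ x) := by
    have h (y : L) : j y = algebraMap R Ω (MvPolynomial.C y) := rfl
    rw [h, h]
    refine (MvPolynomial.fractionSubst_algebraMap σ c _).trans ?_
    rw [MvPolynomial.semilinearSubst_C]
    rfl
  have hθφ : θ.mapMatrix (φΩ a) = j.mapMatrix ((φ a).map σ) := by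
    ext i k
    exact hθj _
  have hθu : θ.mapMatrix (u : Matrix (Fin n) (Fin n) Ω) =
      j.mapMatrix (↑c⁻¹ : Matrix (Fin n) (Fin n) L) * u := by
    ext i k
    rw [hu]
    refine (MvPolynomial.fractionSubst_algebraMap σ c _).trans ?_
    rw [Matrix.mvPolynomialX_apply, MvPolynomial.semilinearSubst_X, map_sum, Matrix.mul_apply]
    refine Finset.sum_congr rfl fun l _ => ?_
    rw [map_mul]
    rfl
  let cΩ : (Matrix (Fin n) (Fin n) Ω)ˣ :=
    Units.map (j.mapMatrix : Matrix (Fin n) (Fin n) L →ₐ[K] Matrix (Fin n) (Fin n) Ω) c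
  have hθu' :
      Units.map (θ.mapMatrix : Matrix (Fin n) (Fin n) Ω →ₐ[K] Matrix (Fin n) (Fin n) Ω) u =
        cΩ⁻¹ * u :=
    Units.ext hθu
  have hθinv : θ.mapMatrix (↑u⁻¹ : Matrix (Fin n) (Fin n) Ω) =
      (↑u⁻¹ : Matrix (Fin n) (Fin n) Ω) * (cΩ : Matrix (Fin n) (Fin n) Ω) := by
    have := congr_arg Units.val (congr_arg (·⁻¹) hθu')
    rw [mul_inv_rev, inv_inv, ← map_inv] at this
    exact this
  have hcΩ : (cΩ : Matrix (Fin n) (Fin n) Ω) * j.mapMatrix ((φ a).map σ) = φΩ a * cΩ := by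
    have := congr_arg j.mapMatrix (hc a)
    rwa [map_mul, map_mul] at this
  rw [hθu, hθφ, hθinv, mul_assoc (↑u⁻¹ : Matrix (Fin n) (Fin n) Ω), hcΩ]
  have : (cΩ : Matrix (Fin n) (Fin n) Ω) * (j.mapMatrix (↑c⁻¹ : Matrix (Fin n) (Fin n) L)) = 1 :=
    cΩ.mul_inv
  rw [mul_assoc, mul_assoc, ← mul_assoc (cΩ : Matrix (Fin n) (Fin n) Ω), this, one_mul, mul_assoc]

/-- If every splitting field of `A` splits `B`, then there is a nonzero vector of rational
functions in the entries of a generic matrix which is an eigenvector of all the semilinear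
substitutions compatible with `φ` and `ψ`. -/
theorem exists_fractionSubst_eigenvector {K L A B : Type} [Field K] [Field L] [Algebra K L]
    [Ring A] [Algebra K A] [DivisionRing B] [Algebra K B] [Algebra.IsCentral K B]
    [FiniteDimensional K B] {n m : ℕ} (hm : Module.finrank K B = m * m)
    (φ : A →ₐ[K] Matrix (Fin n) (Fin n) L) (ψ : B →ₐ[K] Matrix (Fin m) (Fin m) L)
    (h : ∀ (F : Type) [Field F] [Algebra K F], Nonempty (A →ₐ[K] Matrix (Fin n) (Fin n) F) →
      Nonempty (B →ₐ[K] Matrix (Fin m) (Fin m) F)) :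
    ∃ v : Fin m → FractionRing (MvPolynomial (Fin n × Fin n) L), v ≠ 0 ∧
      ∀ (σ : L ≃ₐ[K] L) (c : (Matrix (Fin n) (Fin n) L)ˣ) (b : (Matrix (Fin m) (Fin m) L)ˣ),
        (∀ x, (c : Matrix (Fin n) (Fin n) L) * (φ x).map σ = φ x * c) →
        (∀ x, (b : Matrix (Fin m) (Fin m) L) * (ψ x).map σ = ψ x * b) →
        ∃ μ : FractionRing (MvPolynomial (Fin n × Fin n) L), ((b : Matrix (Fin m) (Fin m) L).map
            (algebraMap L (FractionRing (MvPolynomial (Fin n × Fin n) L)))).mulVec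
          (MvPolynomial.fractionSubst σ c ∘ v) = μ • v := by
  let R := MvPolynomial (Fin n × Fin n) L
  let Ω := FractionRing R
  obtain ⟨ρ, hρ⟩ := φ.exists_forall_map_fractionSubst_eq
  let F : IntermediateField K Ω :=
    { carrier := {x | ∀ (σ : L ≃ₐ[K] L) (c : (Matrix (Fin n) (Fin n) L)ˣ),
        (∀ x, (c : Matrix (Fin n) (Fin n) L) * (φ x).map σ = φ x * c) →
        MvPolynomial.fractionSubst σ c x = x}
      mul_mem' := fun hx hy σ c hc => by rw [map_mul, hx σ c hc, hy σ c hc]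
      add_mem' := fun hx hy σ c hc => by rw [map_add, hx σ c hc, hy σ c hc]
      algebraMap_mem' := fun k σ c _ => AlgHom.commutes _ k
      inv_mem' := fun x hx σ c hc => by rw [map_inv₀, hx σ c hc] }
  have hρF (a : A) (i k : Fin n) : ρ a i k ∈ F := fun σ c hc => congr($(hρ σ c hc a) i k)
  let ρF : A →ₐ[K] Matrix (Fin n) (Fin n) F :=
    { toFun := fun a => Matrix.of fun i k => ⟨ρ a i k, hρF a i k⟩
      map_one' := by
        ext i k
        simp only [map_one, Matrix.of_apply, Matrix.one_apply]
        split_ifs <;> rfl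
      map_mul' := fun x y => by
        ext i k
        simp [Matrix.mul_apply]
      map_zero' := by ext; simp
      map_add' := fun x y => by ext; simp
      commutes' := fun k => by
        ext i l
        simp only [AlgHom.commutes, Matrix.of_apply, Matrix.algebraMap_matrix_apply]
        split_ifs <;> rfl }
  obtain ⟨ψF⟩ := h F ⟨ρF⟩
  let j : L →ₐ[K] Ω := IsScalarTower.toAlgHom K L Ω
  let ψΩ : B →ₐ[K] Matrix (Fin m) (Fin m) Ω := j.mapMatrix.comp ψ
  let χ : B →ₐ[K] Matrix (Fin m) (Fin m) Ω := F.val.mapMatrix.comp ψF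
  obtain ⟨g, hg⟩ := ψΩ.exists_matrix_conj hm χ
  have hm0 : 0 < m := Nat.pos_of_ne_zero (by
    rintro rfl
    exact (Module.finrank_pos (R := K) (M := B)).ne' hm)
  refine ⟨fun i => (g : Matrix (Fin m) (Fin m) Ω) i ⟨0, hm0⟩, fun h0 => ?_,
    fun σ c b hc hb => ?_⟩
  · have := congr($(g.inv_mul) ⟨0, hm0⟩ ⟨0, hm0⟩)
    rw [Matrix.mul_apply, Finset.sum_eq_zero fun i _ => by rw [congr_fun h0 i]; exact mul_zero _,
      Matrix.one_apply_eq] at this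
    exact zero_ne_one this
  let θ : Ω →ₐ[K] Ω := MvPolynomial.fractionSubst σ c
  have hθj (x : L) : θ (j x) = j (σ x) := by
    have h (y : L) : j y = algebraMap R Ω (MvPolynomial.C y) := rfl
    rw [h, h]
    refine (MvPolynomial.fractionSubst_algebraMap σ c _).trans ?_
    rw [MvPolynomial.semilinearSubst_C]
    rfl
  let bΩ : Matrix (Fin m) (Fin m) Ω := j.mapMatrix (b : Matrix (Fin m) (Fin m) L)
  let g' : Matrix (Fin m) (Fin m) Ω := θ.mapMatrix (g : Matrix (Fin m) (Fin m) Ω)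
  have h1 (β : B) : θ.mapMatrix (ψΩ β) = j.mapMatrix ((ψ β).map σ) := by
    ext i k
    exact hθj _
  have h2 (β : B) : θ.mapMatrix (χ β) = χ β := by
    ext i k
    exact (ψF β i k).2 σ c hc
  have h3 (β : B) : ψΩ β * (bΩ * g') = bΩ * g' * χ β := by
    have e1 := congr_arg θ.mapMatrix (hg β)
    rw [map_mul, map_mul, h1, h2] at e1
    have e2 := congr_arg j.mapMatrix (hb β)
    rw [map_mul, map_mul] at e2
    calc ψΩ β * (bΩ * g') = ψΩ β * bΩ * g' := (mul_assoc _ _ _).symm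
      _ = bΩ * j.mapMatrix ((ψ β).map σ) * g' := congr_arg (· * g') e2.symm
      _ = bΩ * (g' * χ β) := by rw [mul_assoc]; exact congr_arg (bΩ * ·) e1
      _ = bΩ * g' * χ β := (mul_assoc _ _ _).symm
  obtain ⟨μ, hμ⟩ := χ.exists_eq_smul_one_of_commute hm
    (x := (↑g⁻¹ : Matrix (Fin m) (Fin m) Ω) * (bΩ * g')) fun β => by
      have e : χ β * (↑g⁻¹ : Matrix (Fin m) (Fin m) Ω) =
          (↑g⁻¹ : Matrix (Fin m) (Fin m) Ω) * ψΩ β := by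
        rw [← Units.inv_mul_eq_iff_eq_mul, inv_inv, ← mul_assoc, ← hg, mul_assoc, Units.mul_inv,
          mul_one]
      rw [← mul_assoc, e, mul_assoc, h3, ← mul_assoc]
  rw [Units.inv_mul_eq_iff_eq_mul, mul_smul_comm, mul_one] at hμ
  refine ⟨μ, ?_⟩
  ext i
  exact congr($hμ i ⟨0, hm0⟩)

theorem IsFractionRing.exists_primitive_vector {R Ω ι : Type*} [CommRing R] [IsDomain R]
    [Nonempty (NormalizedGCDMonoid R)] [Field Ω] [Algebra R Ω] [IsFractionRing R Ω] [Fintype ι]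
    {v : ι → Ω} (hv : v ≠ 0) :
    ∃ (r : Ω) (w : ι → R), r ≠ 0 ∧ (∀ i, algebraMap R Ω (w i) = r * v i) ∧
      ∀ x, (∀ i, x ∣ w i) → IsUnit x := by
  classical
  let _ : NormalizedGCDMonoid R := Classical.choice inferInstance
  have hinj := IsFractionRing.injective R Ω
  obtain ⟨i₀, hi₀⟩ := Function.ne_iff.mp hv
  obtain ⟨⟨D, hD⟩, hDv⟩ := IsLocalization.exist_integer_multiples_of_finite (nonZeroDivisors R) v
  choose u hu using hDv
  have hD0 : algebraMap R Ω D ≠ 0 := fun h0 =>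
    nonZeroDivisors.ne_zero hD (hinj (h0.trans (map_zero _).symm))
  obtain ⟨w, hw, hgcd⟩ := Finset.extract_gcd u (s := Finset.univ) ⟨i₀, Finset.mem_univ _⟩
  have hwv (i : ι) :
      algebraMap R Ω (Finset.univ.gcd u) * algebraMap R Ω (w i) = algebraMap R Ω D * v i := by
    rw [← map_mul, ← hw i (Finset.mem_univ _), hu i]
    exact Algebra.smul_def D (v i)
  have he0 : algebraMap R Ω (Finset.univ.gcd u) ≠ 0 := fun h0 => by
    have := hwv i₀
    rw [h0, zero_mul] at this
    exact mul_ne_zero hD0 hi₀ this.symm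
  refine ⟨algebraMap R Ω D / algebraMap R Ω (Finset.univ.gcd u), w, div_ne_zero hD0 he0,
    fun i => ?_, fun x hx => isUnit_of_dvd_one (hgcd ▸ Finset.dvd_gcd fun i _ => hx i)⟩
  rw [div_mul_eq_mul_div, eq_div_iff he0, mul_comm, hwv]

theorem IsFractionRing.exists_units_mul_eq_of_primitive {R Ω ι : Type*} [CommRing R] [IsDomain R]
    [Nonempty (NormalizedGCDMonoid R)] [Field Ω] [Algebra R Ω] [IsFractionRing R Ω] [Fintype ι]
    {w y : ι → R} (hw : ∀ x, (∀ i, x ∣ w i) → IsUnit x) (hy : ∀ x, (∀ i, x ∣ y i) → IsUnit x)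
    {ν : Ω} (hν : ∀ i, algebraMap R Ω (y i) = ν * algebraMap R Ω (w i)) :
    ∃ ε : Rˣ, ∀ i, y i = ε * w i := by
  let _ : NormalizedGCDMonoid R := Classical.choice inferInstance
  obtain ⟨p, q, hq, rfl⟩ := IsFractionRing.div_surjective (A := R) ν
  have hq0 : algebraMap R Ω q ≠ 0 := fun h0 => nonZeroDivisors.ne_zero hq
    (IsFractionRing.injective R Ω (h0.trans (map_zero _).symm))
  have hpq (i : ι) : q * y i = p * w i := IsFractionRing.injective R Ω (by
    rw [map_mul, map_mul, hν i]
    field_simp)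
  have hgcd (z : ι → R) (hz : ∀ x, (∀ i, x ∣ z i) → IsUnit x) (a : R) :
      Associated (Finset.univ.gcd fun i => a * z i) a := by
    have h1 : Associated (Finset.univ.gcd z) 1 := associated_one_iff_isUnit.mpr
      (hz _ fun i => Finset.gcd_dvd (Finset.mem_univ i))
    have h2 := (Associated.refl a).mul_mul h1
    rw [mul_one] at h2
    exact (Finset.gcd_mul_left' Finset.univ z a).trans h2
  have hassoc : Associated q p := by
    have h1 := hgcd y hy q
    simp only [hpq] at h1
    exact h1.symm.trans (hgcd w hw p)
  obtain ⟨ε, rfl⟩ := hassoc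
  refine ⟨ε, fun i => mul_left_cancel₀ (nonZeroDivisors.ne_zero hq) ?_⟩
  rw [hpq, mul_assoc]

theorem Matrix.primitive_mulVec_comp {R ι : Type*} [CommRing R] [Fintype ι] [DecidableEq ι]
    {s : R →+* R} (hs : Function.Bijective s) (b : (Matrix ι ι R)ˣ) {w : ι → R}
    (hw : ∀ x, (∀ i, x ∣ w i) → IsUnit x) (x : R)
    (hx : ∀ i, x ∣ (b : Matrix ι ι R).mulVec (s ∘ w) i) : IsUnit x := by
  have h : (↑b⁻¹ : Matrix ι ι R).mulVec ((b : Matrix ι ι R).mulVec (s ∘ w)) = s ∘ w := by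
    rw [Matrix.mulVec_mulVec, Units.inv_mul, Matrix.one_mulVec]
  have h1 (i : ι) : x ∣ s (w i) := by
    have := congr_fun h i
    rw [Function.comp_apply] at this
    rw [← this]
    exact Finset.dvd_sum fun k _ => Dvd.dvd.mul_left (hx k) _
  obtain ⟨x', rfl⟩ := hs.surjective x
  refine (hw x' fun i => ?_).map s
  obtain ⟨z, hz⟩ := h1 i
  obtain ⟨z', rfl⟩ := hs.surjective z
  exact ⟨z', hs.injective (by rw [hz, map_mul])⟩

/-- An eigenvector of semilinear substitutions over the field of rational functions yields a
homogeneous polynomial eigenvector with constant eigenvalues. -/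
theorem exists_isHomogeneous_semilinearSubst_eigenvector {K L : Type*} [Field K] [Field L]
    [Algebra K L] {n m : ℕ}
    (P : (L ≃ₐ[K] L) → (Matrix (Fin n) (Fin n) L)ˣ → (Matrix (Fin m) (Fin m) L)ˣ → Prop)
    {v : Fin m → FractionRing (MvPolynomial (Fin n × Fin n) L)} (hv : v ≠ 0)
    (h : ∀ σ c b, P σ c b → ∃ μ : FractionRing (MvPolynomial (Fin n × Fin n) L),
      ((b : Matrix (Fin m) (Fin m) L).map
          (algebraMap L (FractionRing (MvPolynomial (Fin n × Fin n) L)))).mulVec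
        (MvPolynomial.fractionSubst σ c ∘ v) = μ • v) :
    ∃ (d : ℕ) (w : Fin m → MvPolynomial (Fin n × Fin n) L), w ≠ 0 ∧
      (∀ i, (w i).IsHomogeneous d) ∧
      ∀ σ c b, P σ c b → ∃ l : L, ∀ i,
        ∑ k, MvPolynomial.C ((b : Matrix (Fin m) (Fin m) L) i k) *
          MvPolynomial.semilinearSubst (σ : L →ₐ[K] L)
            (↑c⁻¹ : Matrix (Fin n) (Fin n) L) (w k) = MvPolynomial.C l * w i := by
  classical
  obtain ⟨r, w, hr0, hr, hw⟩ := IsFractionRing.exists_primitive_vector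
    (R := MvPolynomial (Fin n × Fin n) L) hv
  have hw0 : w ≠ 0 := by
    rintro rfl
    obtain ⟨i, hi⟩ := Function.ne_iff.mp hv
    have := hr i
    rw [Pi.zero_apply, map_zero] at this
    exact mul_ne_zero hr0 hi this.symm
  have key (σ : L ≃ₐ[K] L) (c b) (hP : P σ c b) : ∃ l : L, ∀ i,
      ∑ k, MvPolynomial.C ((b : Matrix (Fin m) (Fin m) L) i k) *
        MvPolynomial.semilinearSubst (σ : L →ₐ[K] L)
          (↑c⁻¹ : Matrix (Fin n) (Fin n) L) (w k) = MvPolynomial.C l * w i := by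
    have hy := Matrix.primitive_mulVec_comp (s := (MvPolynomial.semilinearSubst (σ : L →ₐ[K] L)
        (↑c⁻¹ : Matrix (Fin n) (Fin n) L)).toRingHom)
      (MvPolynomial.semilinearSubst_bijective σ c)
      (Units.map ((MvPolynomial.C : L →+* MvPolynomial (Fin n × Fin n) L).mapMatrix :
        Matrix (Fin m) (Fin m) L →+* _) b) hw
    obtain ⟨μ, hμ⟩ := h σ c b hP
    obtain ⟨ε, hε⟩ := IsFractionRing.exists_units_mul_eq_of_primitive hw hy
      (ν := MvPolynomial.fractionSubst σ c r * μ * r⁻¹) fun i => by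
        have h2 := congr_fun hμ i
        simp only [Matrix.mulVec, dotProduct, Matrix.map_apply, Function.comp_apply,
          Pi.smul_apply, smul_eq_mul] at h2
        calc _ = ∑ k, algebraMap L (FractionRing (MvPolynomial (Fin n × Fin n) L))
              ((b : Matrix (Fin m) (Fin m) L) i k) *
                (MvPolynomial.fractionSubst σ c r * MvPolynomial.fractionSubst σ c (v k)) := by
              simp only [Matrix.mulVec, dotProduct, map_sum, Function.comp_apply]
              refine Finset.sum_congr rfl fun k _ => ?_
              rw [← map_mul (MvPolynomial.fractionSubst σ c), ← hr,
                MvPolynomial.fractionSubst_algebraMap,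
                map_mul]
              rfl
          _ = MvPolynomial.fractionSubst σ c r * (μ * v i) := by
              rw [← h2, Finset.mul_sum]
              exact Finset.sum_congr rfl fun k _ => mul_left_comm _ _ _
          _ = _ := by
              rw [hr]
              field_simp
    obtain ⟨l, hl, hlε⟩ := MvPolynomial.isUnit_iff_eq_C_of_isReduced.mp ε.isUnit
    refine ⟨l, fun i => ?_⟩
    rw [← hlε, ← hε]
    rfl
  obtain ⟨i, hi⟩ := Function.ne_iff.mp hw0
  obtain ⟨d, hd⟩ : ∃ d, MvPolynomial.homogeneousComponent d (w i) ≠ 0 := by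
    by_contra! h0
    apply hi
    rw [← MvPolynomial.sum_homogeneousComponent (w i), Finset.sum_eq_zero fun d _ => h0 d]
    rfl
  refine ⟨d, fun i => MvPolynomial.homogeneousComponent d (w i),
    Function.ne_iff.mpr ⟨i, hd⟩, fun i => MvPolynomial.homogeneousComponent_isHomogeneous d (w i),
    fun σ c b hP => ?_⟩
  obtain ⟨l, hl⟩ := key σ c b hP
  refine ⟨l, fun i => ?_⟩
  have := congr_arg (MvPolynomial.homogeneousComponent d) (hl i)
  simpa only [map_sum, MvPolynomial.homogeneousComponent_C_mul,
    MvPolynomial.homogeneousComponent_semilinearSubst] using this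

/-- The fixed points of a family of endomorphisms. -/
def Submodule.fixedBy {K V G : Type*} [Field K] [AddCommGroup V] [Module K V]
    (T : G → V →ₗ[K] V) : Submodule K V where
  carrier := {v | ∀ σ, T σ v = v}
  add_mem' hx hy σ := by rw [map_add, hx σ, hy σ]
  zero_mem' σ := map_zero _
  smul_mem' k x hx σ := by rw [map_smul, hx σ]

theorem Submodule.span_fixedBy_eq_top {K L V : Type*} [Field K] [Field L] [Algebra K L]
    [FiniteDimensional K L] [AddCommGroup V] [Module K V] [Module L V]
    (T : (L ≃ₐ[K] L) → V →ₗ[K] V) (hsmul : ∀ σ (a : L) v, T σ (a • v) = σ a • T σ v)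
    (hone : ∀ v, T 1 v = v) (hmul : ∀ σ τ v, T σ (T τ v) = T (σ * τ) v) :
    Submodule.span L (fixedBy T : Set V) = ⊤ := by
  classical
  by_contra hne
  obtain ⟨f, hf0, hf⟩ := Submodule.exists_le_ker_of_lt_top _ (lt_top_iff_ne_top.mpr hne)
  refine hf0 (LinearMap.ext fun u => ?_)
  have hW (a : L) : ∑ σ, T σ (a • u) ∈ fixedBy T := fun τ => by
    rw [map_sum]
    simp only [hmul]
    exact Fintype.sum_equiv (Equiv.mulLeft τ) _ _ fun _ => rfl
  have hsum (a : L) : ∑ σ : L ≃ₐ[K] L, f (T σ u) * σ a = 0 := by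
    have := LinearMap.mem_ker.mp (hf (Submodule.subset_span (hW a)))
    simpa only [hsmul, map_sum, map_smul, smul_eq_mul, mul_comm] using this
  have hind : LinearIndependent L (fun σ : L ≃ₐ[K] L => (σ : L → L)) :=
    (linearIndependent_monoidHom L L).comp
      (fun σ : L ≃ₐ[K] L => ((σ : L →+* L) : L →* L)) fun σ τ h =>
        AlgEquiv.ext fun x => congr($h x)
  have := Fintype.linearIndependent_iff.mp hind (fun σ => f (T σ u))
    (funext fun a => by simpa using hsum a) 1
  rwa [hone] at this

theorem Submodule.finrank_fixedBy {K L V : Type*} [Field K] [Field L] [Algebra K L]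
    [FiniteDimensional K L] [IsGalois K L] [AddCommGroup V] [Module K V] [Module L V]
    [IsScalarTower K L V]
    (T : (L ≃ₐ[K] L) → V →ₗ[K] V) (hsmul : ∀ σ (a : L) v, T σ (a • v) = σ a • T σ v)
    (hone : ∀ v, T 1 v = v) (hmul : ∀ σ τ v, T σ (T τ v) = T (σ * τ) v) :
    Module.finrank K (fixedBy T) = Module.finrank L V := by
  have hspan := span_fixedBy_eq_top T hsmul hone hmul
  let ℬ := Module.Basis.ofSpan hspan.ge
  have hℬ (i) : ℬ i ∈ fixedBy T := Module.Basis.ofSpan_subset hspan.ge ⟨i, rfl⟩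
  have hli : LinearIndependent K fun i => (⟨ℬ i, hℬ i⟩ : fixedBy T) := by
    refine LinearIndependent.of_comp (fixedBy T).subtype ?_
    exact ℬ.linearIndependent.restrict_scalars' K
  let 𝒞 := Module.Basis.mk hli (by
    rintro ⟨w, hw⟩ -
    have hfix (i) : ∃ k : K, algebraMap K L k = ℬ.repr w i := by
      refine (IsGalois.mem_range_algebraMap_iff_fixed _).mpr fun σ => ?_
      have h1 : Finsupp.mapRange σ (map_zero σ) (ℬ.repr w) = ℬ.repr w := by
        apply ℬ.repr.symm.injective
        rw [LinearEquiv.symm_apply_apply]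
        refine Eq.trans ?_ (hw σ)
        conv_rhs => rw [← ℬ.linearCombination_repr w]
        rw [Module.Basis.repr_symm_apply, Finsupp.linearCombination_apply,
          Finsupp.linearCombination_apply, Finsupp.sum_mapRange_index (by simp), map_finsuppSum]
        refine Finsupp.sum_congr fun j _ => ?_
        rw [hsmul, hℬ j σ]
      exact congr($h1 i)
    choose k hk using hfix
    have : (⟨w, hw⟩ : fixedBy T) = ∑ i ∈ (ℬ.repr w).support, k i • ⟨ℬ i, hℬ i⟩ := by
      ext
      rw [Submodule.coe_sum]
      refine (ℬ.linearCombination_repr w).symm.trans ?_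
      rw [Finsupp.linearCombination_apply]
      refine Finset.sum_congr rfl fun i _ => ?_
      rw [← hk]
      exact algebraMap_smul L (k i) (ℬ i)
    rw [this]
    exact Submodule.sum_mem _ fun i _ => Submodule.smul_mem _ _ (Submodule.subset_span ⟨i, rfl⟩))
  rw [Module.finrank_eq_nat_card_basis 𝒞, Module.finrank_eq_nat_card_basis ℬ]

/-- The Kronecker product of a finite family of square matrices. -/
def Matrix.piKronecker {κ n R : Type*} [Fintype κ] [CommSemiring R] (x : κ → Matrix n n R) :
    Matrix (κ → n) (κ → n) R :=
  Matrix.of fun f g => ∏ i, x i (f i) (g i)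

namespace Matrix

section PiKronecker

variable {κ n R : Type*} [Fintype κ] [CommSemiring R]

theorem piKronecker_apply (x : κ → Matrix n n R) (f g : κ → n) :
    piKronecker x f g = ∏ i, x i (f i) (g i) := rfl

theorem piKronecker_one [DecidableEq n] [DecidableEq (κ → n)] :
    piKronecker (1 : κ → Matrix n n R) = 1 := by
  ext f g
  simp [piKronecker_apply, one_apply, Finset.prod_ite_zero, funext_iff]

theorem piKronecker_mul [DecidableEq κ] [Fintype n] (x y : κ → Matrix n n R) :
    piKronecker (x * y) = piKronecker x * piKronecker y := by
  ext f g
  simp only [piKronecker_apply, mul_apply, Pi.mul_apply, ← Finset.prod_mul_distrib,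
    Finset.prod_univ_sum, Fintype.piFinset_univ]

theorem piKronecker_map {S F : Type*} [CommSemiring S] [FunLike F R S] [RingHomClass F R S]
    (σ : F) (x : κ → Matrix n n R) :
    (piKronecker x).map σ = piKronecker fun i => (x i).map σ := by
  ext f g
  simp [piKronecker_apply]

theorem piKronecker_const_smul (t : R) (x : Matrix n n R) :
    piKronecker (fun _ : κ => t • x) = t ^ Fintype.card κ • piKronecker fun _ : κ => x := by
  ext f g
  simp [piKronecker_apply, Finset.prod_mul_distrib]

/-- `Matrix.piKronecker` as a multilinear map over a base ring. -/
def piKroneckerMultilinear (K κ n R : Type*) [Fintype κ] [CommSemiring K] [CommSemiring R]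
    [Algebra K R] :
    MultilinearMap K (fun _ : κ => Matrix n n R) (Matrix (κ → n) (κ → n) R) where
  toFun := piKronecker
  map_update_add' x i a b := by
    ext f g
    have h (y : Matrix n n R) : ∏ j ∈ Finset.univ.erase i, Function.update x i y j (f j) (g j) =
        ∏ j ∈ Finset.univ.erase i, x j (f j) (g j) :=
      Finset.prod_congr rfl fun j hj => by rw [Function.update_of_ne (Finset.ne_of_mem_erase hj)]
    simp only [piKronecker_apply, add_apply,
      ← Finset.mul_prod_erase Finset.univ _ (Finset.mem_univ i),
      h, Function.update_self, add_mul]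
  map_update_smul' x i a b := by
    ext f g
    have h (y : Matrix n n R) : ∏ j ∈ Finset.univ.erase i, Function.update x i y j (f j) (g j) =
        ∏ j ∈ Finset.univ.erase i, x j (f j) (g j) :=
      Finset.prod_congr rfl fun j hj => by rw [Function.update_of_ne (Finset.ne_of_mem_erase hj)]
    simp only [piKronecker_apply, smul_apply,
      ← Finset.mul_prod_erase Finset.univ _ (Finset.mem_univ i),
      h, Function.update_self, smul_mul_assoc]

end PiKronecker

theorem linearIndependent_piKronecker {κ n L ι : Type*} [Fintype κ] [Fintype n] [Field L]
    (b : Module.Basis ι L (Matrix n n L)) :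
    LinearIndependent L fun p : κ → ι => piKronecker fun i => b (p i) := by
  classical
  have hinj : Function.Injective (PiTensorProduct.lift (piKroneckerMultilinear L κ n L)) := by
    let s := Basis.piTensorProduct fun _ : κ => Matrix.stdBasis L n n
    have hs : ⇑(PiTensorProduct.lift (piKroneckerMultilinear L κ n L)) ∘ s =
        Matrix.stdBasis L (κ → n) (κ → n) ∘ fun p => (fun i => (p i).1, fun i => (p i).2) := by
      funext p
      rw [Function.comp_apply, Basis.piTensorProduct_apply, PiTensorProduct.lift.tprod,
        Function.comp_apply, stdBasis_eq_single]
      ext f g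
      refine (piKronecker_apply _ f g).trans ?_
      have h (i : κ) : stdBasis L n n (p i) = single (p i).1 (p i).2 1 :=
        stdBasis_eq_single (R := L) _ _
      simp [h, single_apply, Finset.prod_ite_zero, funext_iff, forall_and]
    refine LinearMap.injective_of_linearIndependent s.span_eq ?_
    rw [hs]
    refine (Matrix.stdBasis L (κ → n) (κ → n)).linearIndependent.comp _ fun p q h => ?_
    exact funext fun i => Prod.ext (congr_fun (Prod.ext_iff.mp h).1 i)
      (congr_fun (Prod.ext_iff.mp h).2 i)
  have := (Basis.piTensorProduct fun _ : κ => b).linearIndependent.map' _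
    (LinearMap.ker_eq_bot.mpr hinj)
  have h : ⇑(PiTensorProduct.lift (piKroneckerMultilinear L κ n L)) ∘
      Basis.piTensorProduct (fun _ : κ => b) = fun p : κ → ι => piKronecker fun i => b (p i) := by
    funext p
    rw [Function.comp_apply, Basis.piTensorProduct_apply, PiTensorProduct.lift.tprod]
    rfl
  rwa [h] at this

end Matrix


/-- The algebra homomorphism from a tensor power induced by a matrix representation. -/
noncomputable def AlgHom.piKronecker {K A L n : Type*} [CommRing K] [Ring A] [Algebra K A]
    [CommRing L] [Algebra K L] [Fintype n] [DecidableEq n] (φ : A →ₐ[K] Matrix n n L) (κ : Type*) [Fintype κ]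
    [DecidableEq κ] :
    PiTensorProduct K (fun _ : κ => A) →ₐ[K] Matrix (κ → n) (κ → n) L :=
  PiTensorProduct.liftAlgHom
    ((Matrix.piKroneckerMultilinear K κ n L).compLinearMap fun _ => φ.toLinearMap)
    (by
      refine (congr_arg Matrix.piKronecker ?_).trans Matrix.piKronecker_one
      exact funext fun _ => map_one φ)
    fun x y => by
      refine (congr_arg Matrix.piKronecker ?_).trans (Matrix.piKronecker_mul _ _)
      exact funext fun i => map_mul φ (x i) (y i)

theorem AlgHom.piKronecker_tprod {K A L n κ : Type*} [CommRing K] [Ring A] [Algebra K A]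
    [CommRing L] [Algebra K L] [Fintype n] [DecidableEq n] [Fintype κ] [DecidableEq κ]
    (φ : A →ₐ[K] Matrix n n L) (x : κ → A) :
    φ.piKronecker κ (PiTensorProduct.tprod K x) = Matrix.piKronecker fun i => φ (x i) :=
  PiTensorProduct.lift.tprod _

theorem AlgHom.piKronecker_injective {K A L κ : Type*} [Field K] [DivisionRing A] [Algebra K A]
    [Algebra.IsCentral K A] [FiniteDimensional K A] [Field L] [Algebra K L] [Fintype κ]
    [DecidableEq κ] {n : ℕ} (hn : Module.finrank K A = n * n)
    (φ : A →ₐ[K] Matrix (Fin n) (Fin n) L) : Function.Injective (φ.piKronecker κ) := by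
  let b := Module.finBasis K A
  have hspan : ⊤ ≤ Submodule.span L (Set.range (φ ∘ b)) := by
    rw [← φ.span_range_matrix_eq_top hn, Submodule.span_le]
    rintro _ ⟨a, rfl⟩
    rw [← b.sum_repr a, map_sum]
    refine Submodule.sum_mem _ fun i _ => ?_
    rw [map_smul, ← algebraMap_smul L]
    exact Submodule.smul_mem _ _ (Submodule.subset_span ⟨i, rfl⟩)
  have hcard : Fintype.card (Fin (Module.finrank K A)) =
      Module.finrank L (Matrix (Fin n) (Fin n) L) := by
    simp [Module.finrank_matrix, hn]
  let b' := basisOfTopLeSpanOfCardEqFinrank (φ ∘ b) hspan hcard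
  have hli := (Matrix.linearIndependent_piKronecker (κ := κ) b').restrict_scalars' K
  refine LinearMap.injective_of_linearIndependent (f := (φ.piKronecker κ).toLinearMap)
    (Basis.piTensorProduct fun _ : κ => b).span_eq ?_
  have h : ⇑(φ.piKronecker κ).toLinearMap ∘ Basis.piTensorProduct (fun _ : κ => b) =
      fun p => Matrix.piKronecker fun i => b' (p i) := by
    funext p
    rw [Function.comp_apply, Basis.piTensorProduct_apply, coe_basisOfTopLeSpanOfCardEqFinrank]
    exact φ.piKronecker_tprod _
  rw [h]
  exact hli

theorem BrauerEquivalent.of_injective_algHom_end {K B C W : Type} [Field K] [DivisionRing B]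
    [Algebra K B] [FiniteDimensional K B] [Ring C] [Algebra K C] [AddCommGroup W] [Module K W]
    [Nontrivial W] [FiniteDimensional K W] [Module Bᵐᵒᵖ W] [IsScalarTower K Bᵐᵒᵖ W]
    (α : C →ₐ[K] Module.End Bᵐᵒᵖ W) (hα : Function.Injective α)
    (hdim : Module.finrank K C * Module.finrank K B = Module.finrank K W * Module.finrank K W) :
    BrauerEquivalent K B C := by
  have : FiniteDimensional Bᵐᵒᵖ W := Module.Finite.of_restrictScalars_finite K _ _
  let r := Module.finrank Bᵐᵒᵖ W
  have hr : 0 < r := Module.finrank_pos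
  have hB : Module.finrank K Bᵐᵒᵖ = Module.finrank K B :=
    (MulOpposite.opLinearEquiv K).finrank_eq.symm
  have hW : Module.finrank K B * r = Module.finrank K W := by
    rw [← hB]
    exact Module.finrank_mul_finrank K Bᵐᵒᵖ W
  let e : Module.End Bᵐᵒᵖ W ≃ₐ[K] Matrix (Fin r) (Fin r) B :=
    ((Module.finBasis Bᵐᵒᵖ W).repr.trans
      (Finsupp.linearEquivFunOnFinite Bᵐᵒᵖ Bᵐᵒᵖ (Fin r))).conjAlgEquiv K |>.trans <|
      (endVecAlgEquivMatrixEnd (Fin r) K Bᵐᵒᵖ Bᵐᵒᵖ).trans <|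
        (AlgEquiv.mapMatrix ((AlgEquiv.opOp K B).trans (AlgEquiv.moduleEndSelf K)).symm)
  let β : C →ₐ[K] Matrix (Fin r) (Fin r) B := e.toAlgHom.comp α
  have hβ : Function.Injective β := e.injective.comp hα
  have hfin : Module.finrank K C = Module.finrank K (Matrix (Fin r) (Fin r) B) := by
    have hpos : 0 < Module.finrank K B := Module.finrank_pos
    refine Nat.eq_of_mul_eq_mul_right hpos ?_
    rw [hdim, ← hW, Module.finrank_matrix]
    simp
    ring
  have : FiniteDimensional K C := Module.Finite.of_injective β.toLinearMap hβ
  have hβ' : Function.Bijective β :=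
    ⟨hβ, (LinearMap.injective_iff_surjective_of_finrank_eq_finrank (f := β.toLinearMap) hfin).mp hβ⟩
  let γ : C ≃ₐ[K] Matrix (Fin 1) (Fin 1) C :=
    { toFun := fun c => Matrix.of fun _ _ => c
      invFun := fun M => M 0 0
      left_inv := fun c => rfl
      right_inv := fun M => by
        ext i j
        rw [Subsingleton.elim i 0, Subsingleton.elim j 0]
        rfl
      map_mul' := fun x y => by
        ext i j
        simp [Matrix.mul_apply]
      map_add' := fun x y => rfl
      commutes' := fun k => by
        ext i j
        simp [Matrix.algebraMap_matrix_apply, Subsingleton.elim i j] }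
  exact ⟨r, 1, hr, one_pos, ⟨(AlgEquiv.ofBijective β hβ').symm.trans γ⟩⟩

/-- The compatibility conditions making `f ↦ l • (c ⊗ ⋯ ⊗ c) * σ f * b⁻¹` a semilinear map which
commutes with the two actions given by `φ` and `ψ` and is independent of the choice of
`(c, b, l)`. -/
structure IsDescentTriple {K L A B : Type*} [Field K] [Field L] [Algebra K L] [Ring A] [Algebra K A]
    [Ring B] [Algebra K B] {n m : ℕ} (φ : A →ₐ[K] Matrix (Fin n) (Fin n) L)
    (ψ : B →ₐ[K] Matrix (Fin m) (Fin m) L) (w : Fin m → MvPolynomial (Fin n × Fin n) L)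
    (σ : L ≃ₐ[K] L) (c : (Matrix (Fin n) (Fin n) L)ˣ) (b : (Matrix (Fin m) (Fin m) L)ˣ)
    (l : L) : Prop where
  left : ∀ x, (c : Matrix (Fin n) (Fin n) L) * (φ x).map σ = φ x * c
  right : ∀ x, (b : Matrix (Fin m) (Fin m) L) * (ψ x).map σ = ψ x * b
  eigen : ∀ i, ∑ k, MvPolynomial.C ((b : Matrix (Fin m) (Fin m) L) i k) *
    MvPolynomial.semilinearSubst (σ : L →ₐ[K] L) (↑c⁻¹ : Matrix (Fin n) (Fin n) L) (w k) =
      MvPolynomial.C l * w i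

/-- The semilinear map `f ↦ l • (c ⊗ ⋯ ⊗ c) * σ f * b⁻¹`. -/
def Matrix.twist {K L : Type*} [Field K] [Field L] [Algebra K L] {n m : ℕ} (d : ℕ)
    (σ : L ≃ₐ[K] L) (c : (Matrix (Fin n) (Fin n) L)ˣ) (b : (Matrix (Fin m) (Fin m) L)ˣ) (l : L) :
    Matrix (Fin d → Fin n) (Fin m) L →ₗ[K] Matrix (Fin d → Fin n) (Fin m) L where
  toFun f := l • (piKronecker (fun _ : Fin d => (c : Matrix (Fin n) (Fin n) L)) * f.map σ *
    (↑b⁻¹ : Matrix (Fin m) (Fin m) L))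
  map_add' f g := by
    rw [Matrix.map_add _ (map_add σ), Matrix.mul_add, Matrix.add_mul, smul_add]
  map_smul' k f := by
    have : (k • f).map σ = k • f.map σ := by
      ext i j
      simp
    rw [this, Matrix.mul_smul, Matrix.smul_mul, smul_comm]
    rfl

theorem Matrix.twist_apply {K L : Type*} [Field K] [Field L] [Algebra K L] {n m d : ℕ}
    (σ : L ≃ₐ[K] L) (c : (Matrix (Fin n) (Fin n) L)ˣ) (b : (Matrix (Fin m) (Fin m) L)ˣ) (l : L)
    (f : Matrix (Fin d → Fin n) (Fin m) L) :
    twist d σ c b l f = l • (piKronecker (fun _ : Fin d => (c : Matrix (Fin n) (Fin n) L)) *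
      f.map σ * (↑b⁻¹ : Matrix (Fin m) (Fin m) L)) := rfl

/-- The entrywise action of a field automorphism on invertible matrices. -/
def Matrix.unitsMap {K L n : Type*} [Field K] [Field L] [Algebra K L] [Fintype n] [DecidableEq n]
    (σ : L ≃ₐ[K] L) : (Matrix n n L)ˣ →* (Matrix n n L)ˣ :=
  Units.map (((σ : L →+* L).mapMatrix : Matrix n n L →+* Matrix n n L) :
    Matrix n n L →* Matrix n n L)

theorem Matrix.coe_unitsMap {K L n : Type*} [Field K] [Field L] [Algebra K L] [Fintype n]
    [DecidableEq n] (σ : L ≃ₐ[K] L) (c : (Matrix n n L)ˣ) :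
    (unitsMap σ c : Matrix n n L) = (c : Matrix n n L).map σ := rfl

theorem Matrix.coe_inv_unitsMap {K L n : Type*} [Field K] [Field L] [Algebra K L] [Fintype n]
    [DecidableEq n] (σ : L ≃ₐ[K] L) (c : (Matrix n n L)ˣ) :
    (↑(unitsMap σ c)⁻¹ : Matrix n n L) = (↑c⁻¹ : Matrix n n L).map σ := rfl

theorem Matrix.coe_inv_eq_smul {L n : Type*} [CommRing L] [Fintype n] [DecidableEq n] {u : L}
    {c c' : (Matrix n n L)ˣ} (h : (c : Matrix n n L) = u • (c' : Matrix n n L)) :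
    (↑c'⁻¹ : Matrix n n L) = u • (↑c⁻¹ : Matrix n n L) := by
  rw [Units.inv_eq_of_mul_eq_one_right]
  rw [Matrix.mul_smul, ← Matrix.smul_mul, ← h, Units.mul_inv]

theorem Matrix.map_mul_inv_of_intertwines {K L A : Type*} [Field K] [Field L] [Algebra K L]
    [Ring A] [Algebra K A] {n : ℕ} {φ : A →ₐ[K] Matrix (Fin n) (Fin n) L} {σ : L ≃ₐ[K] L}
    {c : (Matrix (Fin n) (Fin n) L)ˣ}
    (h : ∀ x, (c : Matrix (Fin n) (Fin n) L) * (φ x).map σ = φ x * c) (x : A) :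
    (φ x).map σ * (↑c⁻¹ : Matrix (Fin n) (Fin n) L) =
      (↑c⁻¹ : Matrix (Fin n) (Fin n) L) * φ x := by
  rw [← Units.inv_mul_eq_iff_eq_mul, inv_inv, ← mul_assoc, h, mul_assoc, Units.mul_inv, mul_one]

theorem Matrix.exists_eq_smul_of_intertwines {K L A : Type*} [Field K] [Field L] [Algebra K L]
    [DivisionRing A] [Algebra K A] [Algebra.IsCentral K A] [FiniteDimensional K A] {n : ℕ}
    (hn : Module.finrank K A = n * n) {φ : A →ₐ[K] Matrix (Fin n) (Fin n) L} {σ : L ≃ₐ[K] L}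
    {c c' : (Matrix (Fin n) (Fin n) L)ˣ}
    (h : ∀ x, (c : Matrix (Fin n) (Fin n) L) * (φ x).map σ = φ x * c)
    (h' : ∀ x, (c' : Matrix (Fin n) (Fin n) L) * (φ x).map σ = φ x * c') :
    ∃ t : L, (c' : Matrix (Fin n) (Fin n) L) = t • (c : Matrix (Fin n) (Fin n) L) := by
  obtain ⟨t, ht⟩ := φ.exists_eq_smul_one_of_commute hn
    (x := (c' : Matrix (Fin n) (Fin n) L) * (↑c⁻¹ : Matrix (Fin n) (Fin n) L)) fun x => by
      rw [← mul_assoc, ← h', mul_assoc, map_mul_inv_of_intertwines h, mul_assoc]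
  refine ⟨t, ?_⟩
  rw [Units.mul_inv_eq_iff_eq_mul, smul_mul_assoc, one_mul] at ht
  exact ht

namespace IsDescentTriple

section

variable {K L A B : Type*} [Field K] [Field L] [Algebra K L] [Ring A] [Algebra K A]
  [Ring B] [Algebra K B] {n m : ℕ}
  {φ : A →ₐ[K] Matrix (Fin n) (Fin n) L} {ψ : B →ₐ[K] Matrix (Fin m) (Fin m) L}
  {w : Fin m → MvPolynomial (Fin n × Fin n) L} {σ τ : L ≃ₐ[K] L}
  {c c' : (Matrix (Fin n) (Fin n) L)ˣ} {b b' : (Matrix (Fin m) (Fin m) L)ˣ} {l l' : L}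

variable (φ ψ w) in
theorem one : IsDescentTriple φ ψ w 1 1 1 1 where
  left x := (one_mul _).trans (mul_one _).symm
  right x := (one_mul _).trans (mul_one _).symm
  eigen i := by
    have h (k : Fin m) : MvPolynomial.semilinearSubst ((1 : L ≃ₐ[K] L) : L →ₐ[K] L)
        ((1 : Matrix (Fin n) (Fin n) L)) (w k) = w k := MvPolynomial.semilinearSubst_id _
    rw [inv_one, Units.val_one, Units.val_one, map_one, one_mul]
    simp only [h]
    rw [Finset.sum_eq_single i (fun k _ hk => by
      rw [Matrix.one_apply_ne hk.symm, map_zero, zero_mul]) (by simp)]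
    rw [Matrix.one_apply_eq, map_one, one_mul]

theorem mul (h : IsDescentTriple φ ψ w σ c b l) (h' : IsDescentTriple φ ψ w τ c' b' l') :
    IsDescentTriple φ ψ w (σ * τ) (c * Matrix.unitsMap σ c') (b * Matrix.unitsMap σ b')
      (l * σ l') where
  left x := by
    have e := congr_arg (Matrix.map · σ) (h'.left x)
    simp only [Matrix.map_mul] at e
    rw [Units.val_mul, Matrix.coe_unitsMap, mul_assoc, ← mul_assoc (φ x), ← h.left, mul_assoc, ← e]
    rfl
  right x := by
    have e := congr_arg (Matrix.map · σ) (h'.right x)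
    simp only [Matrix.map_mul] at e
    rw [Units.val_mul, Matrix.coe_unitsMap, mul_assoc, ← mul_assoc (ψ x), ← h.right, mul_assoc, ← e]
    rfl
  eigen i := by
    have hs (k : Fin m) : MvPolynomial.semilinearSubst ((σ * τ : L ≃ₐ[K] L) : L →ₐ[K] L)
        (↑(c * Matrix.unitsMap σ c')⁻¹ : Matrix (Fin n) (Fin n) L) (w k) =
          MvPolynomial.semilinearSubst (σ : L →ₐ[K] L) (↑c⁻¹ : Matrix (Fin n) (Fin n) L)
            (MvPolynomial.semilinearSubst (τ : L →ₐ[K] L) (↑c'⁻¹ : Matrix (Fin n) (Fin n) L)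
              (w k)) := by
      rw [MvPolynomial.semilinearSubst_semilinearSubst, mul_inv_rev, Units.val_mul,
        Matrix.coe_inv_unitsMap]
      rfl
    have h1 (j : Fin m) := congr_arg (MvPolynomial.semilinearSubst (σ : L →ₐ[K] L)
      (↑c⁻¹ : Matrix (Fin n) (Fin n) L)) (h'.eigen j)
    simp only [map_sum, map_mul, MvPolynomial.semilinearSubst_C] at h1
    simp only [hs, Units.val_mul, Matrix.coe_unitsMap, Matrix.mul_apply, Matrix.map_apply, map_sum,
      map_mul, Finset.sum_mul]
    rw [Finset.sum_comm]
    calc _ = ∑ j, MvPolynomial.C ((b : Matrix (Fin m) (Fin m) L) i j) *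
          (MvPolynomial.C (σ l') * MvPolynomial.semilinearSubst (σ : L →ₐ[K] L)
            (↑c⁻¹ : Matrix (Fin n) (Fin n) L) (w j)) := by
          refine Finset.sum_congr rfl fun j _ => ?_
          refine Eq.trans ?_ (congr_arg (_ * ·) (h1 j))
          rw [Finset.mul_sum]
          exact Finset.sum_congr rfl fun k _ => mul_assoc _ _ _
      _ = MvPolynomial.C (σ l') * (MvPolynomial.C l * w i) := by
          rw [← h.eigen i, Finset.mul_sum]
          exact Finset.sum_congr rfl fun j _ => mul_left_comm _ _ _
      _ = _ := by ring

theorem twist_twist (d : ℕ) (f : Matrix (Fin d → Fin n) (Fin m) L) :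
    Matrix.twist d σ c b l (Matrix.twist d τ c' b' l' f) =
      Matrix.twist d (σ * τ) (c * Matrix.unitsMap σ c') (b * Matrix.unitsMap σ b')
        (l * σ l') f := by
  have hsmul (g : Matrix (Fin d → Fin n) (Fin m) L) : (l' • g).map σ = σ l' • g.map σ := by
    ext i j
    simp
  have hK : (Matrix.piKronecker fun _ : Fin d =>
      (↑(c * Matrix.unitsMap σ c') : Matrix (Fin n) (Fin n) L)) =
        Matrix.piKronecker (fun _ : Fin d => (c : Matrix (Fin n) (Fin n) L)) *
          (Matrix.piKronecker fun _ : Fin d => (c' : Matrix (Fin n) (Fin n) L)).map σ := by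
    rw [Matrix.piKronecker_map, ← Matrix.piKronecker_mul]
    rfl
  have hf : f.map (σ * τ : L ≃ₐ[K] L) = (f.map τ).map σ := rfl
  rw [Matrix.twist_apply, Matrix.twist_apply, Matrix.twist_apply, hsmul, Matrix.map_mul,
    Matrix.map_mul, hK, mul_inv_rev, Units.val_mul,
    Matrix.coe_inv_unitsMap, Matrix.mul_smul, Matrix.smul_mul, smul_smul, hf]
  simp only [Matrix.mul_assoc]

theorem twist_mul_left (h : IsDescentTriple φ ψ w σ c b l) (d : ℕ)
    (x : PiTensorProduct K fun _ : Fin d => A) (f : Matrix (Fin d → Fin n) (Fin m) L) :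
    Matrix.twist d σ c b l (φ.piKronecker (Fin d) x * f) =
      φ.piKronecker (Fin d) x * Matrix.twist d σ c b l f := by
  induction x using PiTensorProduct.induction_on with
  | smul_tprod r x =>
    have e : Matrix.piKronecker (fun _ : Fin d => (c : Matrix (Fin n) (Fin n) L)) *
        (Matrix.piKronecker fun i => φ (x i)).map σ =
          (Matrix.piKronecker fun i => φ (x i)) *
            Matrix.piKronecker (fun _ : Fin d => (c : Matrix (Fin n) (Fin n) L)) := by
      rw [Matrix.piKronecker_map, ← Matrix.piKronecker_mul, ← Matrix.piKronecker_mul]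
      exact congr_arg Matrix.piKronecker (funext fun i => h.left (x i))
    rw [map_smul, Matrix.smul_mul, Matrix.smul_mul, map_smul, φ.piKronecker_tprod]
    congr 1
    rw [Matrix.twist_apply, Matrix.twist_apply, Matrix.map_mul, ← Matrix.mul_assoc, e,
      Matrix.mul_smul]
    simp only [Matrix.mul_assoc]
  | add x y hx hy => rw [map_add, Matrix.add_mul, map_add, hx, hy, Matrix.add_mul]

theorem twist_mul_right (h : IsDescentTriple φ ψ w σ c b l) (d : ℕ) (y : B)
    (f : Matrix (Fin d → Fin n) (Fin m) L) :
    Matrix.twist d σ c b l (f * ψ y) = Matrix.twist d σ c b l f * ψ y := by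
  rw [Matrix.twist_apply, Matrix.twist_apply, Matrix.map_mul, Matrix.smul_mul]
  simp only [Matrix.mul_assoc, Matrix.map_mul_inv_of_intertwines h.right]

theorem twist_smul (d : ℕ) (a : L) (f : Matrix (Fin d → Fin n) (Fin m) L) :
    Matrix.twist d σ c b l (a • f) = σ a • Matrix.twist d σ c b l f := by
  have hsmul : (a • f).map σ = σ a • f.map σ := by
    ext i j
    simp
  rw [Matrix.twist_apply, Matrix.twist_apply, hsmul, Matrix.mul_smul, Matrix.smul_mul, smul_comm]

theorem twist_one (d : ℕ) (f : Matrix (Fin d → Fin n) (Fin m) L) :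
    Matrix.twist d (1 : L ≃ₐ[K] L) 1 1 1 f = f := by
  have h : (Matrix.piKronecker fun _ : Fin d => ((1 : (Matrix (Fin n) (Fin n) L)ˣ) :
      Matrix (Fin n) (Fin n) L)) = 1 := Matrix.piKronecker_one
  have h1 : f.map (1 : L ≃ₐ[K] L) = f := rfl
  rw [Matrix.twist_apply, h, h1, one_smul, inv_one, Units.val_one, Matrix.mul_one, Matrix.one_mul]

end

theorem twist_eq {K L A B : Type*} [Field K] [Field L] [Algebra K L] [DivisionRing A]
    [Algebra K A] [Algebra.IsCentral K A] [FiniteDimensional K A] [DivisionRing B] [Algebra K B]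
    [Algebra.IsCentral K B] [FiniteDimensional K B] {n m : ℕ}
    (hn : Module.finrank K A = n * n) (hm : Module.finrank K B = m * m)
    {φ : A →ₐ[K] Matrix (Fin n) (Fin n) L} {ψ : B →ₐ[K] Matrix (Fin m) (Fin m) L}
    {w : Fin m → MvPolynomial (Fin n × Fin n) L} {σ : L ≃ₐ[K] L}
    {c c' : (Matrix (Fin n) (Fin n) L)ˣ} {b b' : (Matrix (Fin m) (Fin m) L)ˣ} {l l' : L} {d : ℕ}
    (hw : w ≠ 0) (hwd : ∀ i, (w i).IsHomogeneous d)
    (h : IsDescentTriple φ ψ w σ c b l) (h' : IsDescentTriple φ ψ w σ c' b' l') :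
    Matrix.twist d σ c b l = Matrix.twist d σ c' b' l' := by
  obtain ⟨u, hu⟩ := Matrix.exists_eq_smul_of_intertwines hn h'.left h.left
  obtain ⟨s, hs⟩ := Matrix.exists_eq_smul_of_intertwines hm h.right h'.right
  have hinv : (↑c'⁻¹ : Matrix (Fin n) (Fin n) L) = u • (↑c⁻¹ : Matrix (Fin n) (Fin n) L) :=
    Matrix.coe_inv_eq_smul hu
  have hl : l' = s * u ^ d * l := by
    obtain ⟨i, hi⟩ := Function.ne_iff.mp hw
    have e := h'.eigen i
    simp only [hinv, hs, (hwd _).semilinearSubst_smul, Matrix.smul_apply, smul_eq_mul, map_mul] at e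
    have e2 : MvPolynomial.C (s * u ^ d * l) * w i = MvPolynomial.C l' * w i := by
      rw [← e, map_mul, mul_assoc, ← h.eigen i, Finset.mul_sum, map_mul]
      exact Finset.sum_congr rfl fun k _ => by ring
    exact (MvPolynomial.C_injective _ _ (mul_right_cancel₀ hi e2)).symm
  refine LinearMap.ext fun f => ?_
  have hb : (↑b⁻¹ : Matrix (Fin m) (Fin m) L) = s • (↑b'⁻¹ : Matrix (Fin m) (Fin m) L) :=
    Matrix.coe_inv_eq_smul hs
  rw [Matrix.twist_apply, Matrix.twist_apply, hb, hu, Matrix.piKronecker_const_smul, hl,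
    Fintype.card_fin, Matrix.mul_smul,
    Matrix.smul_mul, Matrix.smul_mul, smul_smul, smul_smul]
  congr 1
  ring

end IsDescentTriple

/-- If every splitting field of `A` splits `B`, then `B` is Brauer equivalent to a tensor power
of `A`. -/
theorem exists_brauerEquivalent_piTensorProduct {K L A B : Type} [Field K] [Field L] [Algebra K L]
    [FiniteDimensional K L] [IsGalois K L] [DivisionRing A] [Algebra K A] [Algebra.IsCentral K A]
    [FiniteDimensional K A] [DivisionRing B] [Algebra K B] [Algebra.IsCentral K B]
    [FiniteDimensional K B] {n m : ℕ} (hn : Module.finrank K A = n * n)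
    (hm : Module.finrank K B = m * m) (φ : A →ₐ[K] Matrix (Fin n) (Fin n) L)
    (h : ∀ (F : Type) [Field F] [Algebra K F], Nonempty (A →ₐ[K] Matrix (Fin n) (Fin n) F) →
      Nonempty (B →ₐ[K] Matrix (Fin m) (Fin m) F)) :
    ∃ d : ℕ, BrauerEquivalent K B (PiTensorProduct K fun _ : Fin d => A) := by
  obtain ⟨ψ⟩ := h L ⟨φ⟩
  obtain ⟨v, hv, hvP⟩ := exists_fractionSubst_eigenvector hm φ ψ h
  obtain ⟨d, w, hw, hwd, hwP⟩ := exists_isHomogeneous_semilinearSubst_eigenvector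
    (fun (σ : L ≃ₐ[K] L) (c : (Matrix (Fin n) (Fin n) L)ˣ) (b : (Matrix (Fin m) (Fin m) L)ˣ) =>
      (∀ x, (c : Matrix (Fin n) (Fin n) L) * (φ x).map σ = φ x * c) ∧
        ∀ x, (b : Matrix (Fin m) (Fin m) L) * (ψ x).map σ = ψ x * b)
    hv fun σ c b hP => hvP σ c b hP.1 hP.2
  have hex (σ : L ≃ₐ[K] L) : ∃ c b l, IsDescentTriple φ ψ w σ c b l := by
    obtain ⟨c, hc⟩ := φ.exists_matrix_conj hn ((σ : L →ₐ[K] L).mapMatrix.comp φ)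
    obtain ⟨b, hb⟩ := ψ.exists_matrix_conj hm ((σ : L →ₐ[K] L).mapMatrix.comp ψ)
    obtain ⟨l, hl⟩ := hwP σ c b ⟨fun x => (hc x).symm, fun x => (hb x).symm⟩
    exact ⟨c, b, l, fun x => (hc x).symm, fun x => (hb x).symm, hl⟩
  choose c b l hT using hex
  let T (σ : L ≃ₐ[K] L) := Matrix.twist d σ (c σ) (b σ) (l σ)
  have hsmul (σ) (a : L) (f) : T σ (a • f) = σ a • T σ f := IsDescentTriple.twist_smul d a f
  have hone (f) : T 1 f = f := by
    refine Eq.trans ?_ (IsDescentTriple.twist_one (K := K) d f)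
    exact congr($(IsDescentTriple.twist_eq hn hm hw hwd (hT 1) (.one φ ψ w)) f)
  have hmul (σ τ f) : T σ (T τ f) = T (σ * τ) f :=
    (IsDescentTriple.twist_twist d f).trans
      congr($(IsDescentTriple.twist_eq hn hm hw hwd ((hT σ).mul (hT τ)) (hT (σ * τ))) f)
  let W := Submodule.fixedBy T
  have hspan := Submodule.span_fixedBy_eq_top T hsmul hone hmul
  have hn0 : n ≠ 0 := by
    rintro rfl
    exact (Module.finrank_pos (R := K) (M := A)).ne' hn
  have hm0 : m ≠ 0 := by
    rintro rfl
    exact (Module.finrank_pos (R := K) (M := B)).ne' hm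
  have hrank : Module.finrank K W = n ^ d * m := by
    refine (Submodule.finrank_fixedBy T hsmul hone hmul).trans ?_
    simp [Module.finrank_matrix]
  have : Nontrivial W := Module.nontrivial_of_finrank_pos (R := K)
    (hrank ▸ Nat.pos_of_ne_zero (mul_ne_zero (pow_ne_zero d hn0) hm0))
  have : FiniteDimensional K (Matrix (Fin d → Fin n) (Fin m) L) := Module.Finite.trans L _
  let _ : Module Bᵐᵒᵖ W :=
    { smul := fun y f => ⟨f.1 * ψ y.unop, fun σ => by
        refine ((hT σ).twist_mul_right d y.unop f.1).trans ?_
        exact congr_arg (· * ψ y.unop) (f.2 σ)⟩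
      one_smul := fun f => Subtype.ext <| by
        change f.1 * ψ 1 = f.1
        rw [map_one, Matrix.mul_one]
      mul_smul := fun x y f => Subtype.ext <| by
        change f.1 * ψ (y.unop * x.unop) = f.1 * ψ y.unop * ψ x.unop
        rw [map_mul, Matrix.mul_assoc]
      smul_zero := fun y => Subtype.ext (Matrix.zero_mul _)
      smul_add := fun y f g => Subtype.ext (Matrix.add_mul _ _ _)
      add_smul := fun x y f => Subtype.ext <| by
        change f.1 * ψ (x.unop + y.unop) = f.1 * ψ x.unop + f.1 * ψ y.unop
        rw [map_add, Matrix.mul_add]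
      zero_smul := fun f => Subtype.ext <| by
        change f.1 * ψ 0 = 0
        rw [map_zero, Matrix.mul_zero] }
  have hWsmul (y : Bᵐᵒᵖ) (f : W) : ((y • f : W) : Matrix (Fin d → Fin n) (Fin m) L) =
      f.1 * ψ y.unop := rfl
  have : IsScalarTower K Bᵐᵒᵖ W := ⟨fun k y f => Subtype.ext <| by
    rw [hWsmul, MulOpposite.unop_smul, map_smul, Matrix.mul_smul, Submodule.coe_smul, hWsmul]⟩
  let Φ := φ.piKronecker (Fin d)
  let α : (PiTensorProduct K fun _ : Fin d => A) →ₐ[K] Module.End Bᵐᵒᵖ W :=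
    { toFun := fun x =>
        { toFun := fun f => ⟨Φ x * f.1, fun σ => by
            refine ((hT σ).twist_mul_left d x f.1).trans ?_
            exact congr_arg (Φ x * ·) (f.2 σ)⟩
          map_add' := fun f g => Subtype.ext (Matrix.mul_add _ _ _)
          map_smul' := fun y f => Subtype.ext (Matrix.mul_assoc _ _ _).symm }
      map_one' := by
        ext f : 2
        change Φ 1 * f.1 = f.1
        rw [map_one, Matrix.one_mul]
      map_mul' := fun x y => by
        ext f : 2
        change Φ (x * y) * f.1 = Φ x * (Φ y * f.1)
        rw [map_mul, Matrix.mul_assoc]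
      map_zero' := by
        ext f : 2
        change Φ 0 * f.1 = 0
        rw [map_zero, Matrix.zero_mul]
      map_add' := fun x y => by
        ext f : 2
        change Φ (x + y) * f.1 = Φ x * f.1 + Φ y * f.1
        rw [map_add, Matrix.add_mul]
      commutes' := fun k => by
        ext f : 2
        change Φ (algebraMap K _ k) * f.1 = k • f.1
        rw [AlgHom.commutes, Algebra.algebraMap_eq_smul_one, Matrix.smul_mul, Matrix.one_mul] }
  have hα : Function.Injective α := by
    refine (injective_iff_map_eq_zero α).mpr fun x hx => ?_
    refine (injective_iff_map_eq_zero Φ).mp (φ.piKronecker_injective hn) x ?_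
    have hker (f : Matrix (Fin d → Fin n) (Fin m) L) : Φ x * f = 0 := by
      have hf : f ∈ Submodule.span L (Submodule.fixedBy T : Set _) := hspan ▸ Submodule.mem_top
      induction hf using Submodule.span_induction with
      | mem f hf => exact congr_arg Subtype.val (congr($hx ⟨f, hf⟩))
      | zero => exact Matrix.mul_zero _
      | add f g _ _ hf hg => rw [Matrix.mul_add, hf, hg, add_zero]
      | smul a f _ hf => rw [Matrix.mul_smul, hf, smul_zero]
    ext i j
    have := congr($(hker (Matrix.single j ⟨0, Nat.pos_of_ne_zero hm0⟩ 1)) i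
      ⟨0, Nat.pos_of_ne_zero hm0⟩)
    simpa using this
  refine ⟨d, .of_injective_algHom_end α hα ?_⟩
  rw [Module.finrank_eq_card_basis (Basis.piTensorProduct fun _ : Fin d => Module.finBasis K A),
    hrank, hm]
  simp [hn]
  ring

theorem degree_dvd_of_splits {K A B : Type} [Field K] [DivisionRing A] [Algebra K A]
    [Algebra.IsCentral K A] [FiniteDimensional K A] [DivisionRing B] [Algebra K B]
    [Algebra.IsCentral K B] [FiniteDimensional K B] {n m : ℕ} (hn : Module.finrank K A = n * n)
    (hm : Module.finrank K B = m * m)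
    (h : ∀ (F : Type) [Field F] [Algebra K F], Nonempty (A →ₐ[K] Matrix (Fin n) (Fin n) F) →
      Nonempty (B →ₐ[K] Matrix (Fin m) (Fin m) F)) : m ∣ n := by
  obtain ⟨P, _, _, ι, hι⟩ := exists_maximal_subfield K A
  have : FiniteDimensional K P := .of_injective ι.toLinearMap ι.injective
  obtain ⟨hP, hφ⟩ := exists_algHom_matrix_of_maximal_subfield ι hι hn
  obtain ⟨ψ⟩ := h P hφ
  exact hP ▸ ψ.dvd_finrank_of_matrix hm

/-- Amitsur: Let `D₁` and `D₂` be finite-dimensional central division algebras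
over a field `K` having the same splitting fields: for every field extension `F/K`, the
algebra `D₁ ⊗[K] F` is a matrix algebra over `F` iff `D₂ ⊗[K] F` is. Then `D₁` and `D₂` have
the same degree, and the classes `[D₁]` and `[D₂]` generate the same cyclic subgroup of the
Brauer group `Br(K)` (each class is a power of the other; since Brauer classes of
finite-dimensional central simple algebras are torsion, nonnegative tensor powers suffice). -/
theorem amitsur_same_splitting_fields
    (K : Type) [Field K]
    (D₁ D₂ : Type) [DivisionRing D₁] [Algebra K D₁] [DivisionRing D₂] [Algebra K D₂]
    [Algebra.IsCentral K D₁] [FiniteDimensional K D₁]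
    [Algebra.IsCentral K D₂] [FiniteDimensional K D₂]
    (hsplit : ∀ (F : Type) [Field F] [Algebra K F],
      SplitsAlg K D₁ F ↔ SplitsAlg K D₂ F) :
    Module.finrank K D₁ = Module.finrank K D₂ ∧
    (∃ k : ℕ, BrauerEquivalent K D₁ (PiTensorProduct K (fun _ : Fin k => D₂))) ∧
    (∃ k : ℕ, BrauerEquivalent K D₂ (PiTensorProduct K (fun _ : Fin k => D₁))) := by
  obtain ⟨n₁, h₁, L₁, _, _, _, _, ⟨φ₁⟩⟩ := exists_finite_isGalois_algHom_matrix K D₁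
  obtain ⟨n₂, h₂, L₂, _, _, _, _, ⟨φ₂⟩⟩ := exists_finite_isGalois_algHom_matrix K D₂
  have h (F : Type) [Field F] [Algebra K F] : Nonempty (D₁ →ₐ[K] Matrix (Fin n₁) (Fin n₁) F) ↔
      Nonempty (D₂ →ₐ[K] Matrix (Fin n₂) (Fin n₂) F) := by
    rw [← splitsAlg_iff_nonempty_algHom h₁, hsplit, splitsAlg_iff_nonempty_algHom h₂]
  have hdeg : n₁ = n₂ := Nat.dvd_antisymm
    (degree_dvd_of_splits h₂ h₁ fun F _ _ => (h F).mpr)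
    (degree_dvd_of_splits h₁ h₂ fun F _ _ => (h F).mp)
  exact ⟨by rw [h₁, h₂, hdeg],
    exists_brauerEquivalent_piTensorProduct h₂ h₁ φ₂ fun F _ _ => (h F).mpr,
    exists_brauerEquivalent_piTensorProduct h₁ h₂ φ₁ fun F _ _ => (h F).mp⟩
end
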